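/- For every integer k > 3, the set of α in the open interval (1 − 1/2^{k−1}, 1) such that G(n, n^{−α}) does not obey the zero-one k-law is finite; equivalently, S_k^1 ∩ (1 − 1/2^{k−1}, 1) is finite. -/

import Mathlib

open Filter Topology FirstOrder

namespace RandomGraphSpectra

/-- The quantifier depth of a first-order (bounded) formula. -/
def qDepth {L : FirstOrder.Language} {α : Type*} :
    ∀ {n : ℕ}, L.BoundedFormula α n → ℕ
  | _, .falsum => 0
  | _, .equal _ _ => 0
  | _, .rel _ _ => 0
  | _, .imp f g => max (qDepth f) (qDepth g)
  | _, .all f => qDepth f + 1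

/-- A simple graph satisfies a first-order sentence in the language of graphs. -/
def GraphSat {V : Type*} (G : SimpleGraph V) (φ : FirstOrder.Language.graph.Sentence) : Prop :=
  @FirstOrder.Language.Sentence.Realize FirstOrder.Language.graph V G.structure φ

/-- The number of edges of a simple graph. -/
noncomputable def edgeCount {V : Type*} (G : SimpleGraph V) : ℕ := Nat.card G.edgeSet

/-- The probability that `G(n,p)` equals a fixed graph `G` on `{1,…,n}`. -/
noncomputable def weight (n : ℕ) (p : ℝ) (G : SimpleGraph (Fin n)) : ℝ :=
  p ^ edgeCount G * (1 - p) ^ (n.choose 2 - edgeCount G)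

open Classical in
/-- The probability that the Erdős–Rényi random graph `G(n,p)` satisfies a predicate `P`. -/
noncomputable def probPred (n : ℕ) (p : ℝ) (P : SimpleGraph (Fin n) → Prop) : ℝ :=
  ∑ᶠ G : SimpleGraph (Fin n), if P G then weight n p G else 0

/-- The probability that `G(n,p)` satisfies a first-order sentence. -/
noncomputable def probSat (n : ℕ) (p : ℝ) (φ : FirstOrder.Language.graph.Sentence) : ℝ :=
  probPred n p (fun G => GraphSat G φ)

open Classical in
/-- The probability that the pair of independent random graphs `G(n,p), G(m,q)`
satisfies a predicate `P`. -/
noncomputable def probPred2 (n m : ℕ) (p q : ℝ)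
    (P : SimpleGraph (Fin n) → SimpleGraph (Fin m) → Prop) : ℝ :=
  ∑ᶠ G : SimpleGraph (Fin n), ∑ᶠ H : SimpleGraph (Fin m),
    if P G H then weight n p G * weight m q H else 0

/-- The spectrum `S_k^1`: the set of `α ∈ (0,1)` such that for some first-order sentence `φ`
of quantifier depth at most `k`, with `p(n) = n^{-α}`, the probability that `G(n,p(n)) ⊨ φ`
does not tend to `0` and does not tend to `1`. -/
def S1 (k : ℕ) : Set ℝ :=
  {α | α ∈ Set.Ioo (0 : ℝ) 1 ∧ ∃ φ : FirstOrder.Language.graph.Sentence, qDepth φ ≤ k ∧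
    ¬(Tendsto (fun n : ℕ => probSat n ((n : ℝ) ^ (-α)) φ) atTop (nhds 0) ∨
      Tendsto (fun n : ℕ => probSat n ((n : ℝ) ^ (-α)) φ) atTop (nhds 1))}

/-- The spectrum `S_k^2`. -/
def S2 (k : ℕ) : Set ℝ :=
  {α | α ∈ Set.Ioo (0 : ℝ) 1 ∧ ∃ φ : FirstOrder.Language.graph.Sentence, qDepth φ ≤ k ∧
    ¬∃ δ : ℝ, (δ = 0 ∨ δ = 1) ∧ ∃ ε : ℝ, 0 < ε ∧ ∀ p : ℕ → ℝ,
      (∀ n : ℕ, 1 ≤ n → (n : ℝ) ^ (-α - ε) < p n ∧ p n < (n : ℝ) ^ (-α + ε)) →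
      Tendsto (fun n : ℕ => probSat n (p n) φ) atTop (nhds δ)}

/-- `G(n, p(n))` obeys the zero-one `k`-law. -/
def ZeroOneKLaw (k : ℕ) (p : ℕ → ℝ) : Prop :=
  ∀ φ : FirstOrder.Language.graph.Sentence, qDepth φ ≤ k →
    Tendsto (fun n : ℕ => probSat n (p n) φ) atTop (nhds 0) ∨
    Tendsto (fun n : ℕ => probSat n (p n) φ) atTop (nhds 1)

/-- The density `ρ(G) = e(G)/v(G)` of a graph. -/
noncomputable def density {V : Type*} (G : SimpleGraph V) : ℝ :=
  (Nat.card G.edgeSet : ℝ) / (Nat.card V : ℝ)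

/-- A graph is strictly balanced if every proper subgraph with at least one vertex has
strictly smaller density. -/
def StrictlyBalanced {V : Type*} (G : SimpleGraph V) : Prop :=
  ∀ H : G.Subgraph, H ≠ ⊤ → H.verts.Nonempty → density H.coe < density G

/-- `ρ^max(G)`: the maximum density of a subgraph of `G` with at least one vertex. -/
noncomputable def maxDensity {V : Type*} (G : SimpleGraph V) : ℝ :=
  sSup {x : ℝ | ∃ H : G.Subgraph, H.verts.Nonempty ∧ x = density H.coe}

/-- The relative density `ρ(K,H) = e(K,H)/v(K,H)` of a pair of nested subgraphs. -/
noncomputable def pairDensity {V : Type*} {G : SimpleGraph V} (K H : G.Subgraph) : ℝ :=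
  ((Nat.card K.edgeSet : ℝ) - (Nat.card H.edgeSet : ℝ)) /
    ((Nat.card K.verts : ℝ) - (Nat.card H.verts : ℝ))

/-- `ρ^max(G,H)` where the ambient graph `G` corresponds to the top subgraph. -/
noncomputable def maxPairDensity {V : Type*} {G : SimpleGraph V} (H : G.Subgraph) : ℝ :=
  sSup {x : ℝ | ∃ K : G.Subgraph, H < K ∧ x = pairDensity K H}

/-- `f_α(K,H) = v(K,H) - α·e(K,H)`. -/
noncomputable def fAlpha (α : ℝ) {V : Type*} {G : SimpleGraph V} (K H : G.Subgraph) : ℝ :=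
  ((Nat.card K.verts : ℝ) - (Nat.card H.verts : ℝ)) -
    α * ((Nat.card K.edgeSet : ℝ) - (Nat.card H.edgeSet : ℝ))

/-- The pair `(G,H)` is `α`-safe: `f_α(S,H) > 0` for every `S` with `H ⊂ S ⊆ G`. -/
def AlphaSafe (α : ℝ) {V : Type*} (G : SimpleGraph V) (H : G.Subgraph) : Prop :=
  ∀ S : G.Subgraph, H < S → 0 < fAlpha α S H

/-- The pair `(G,H)` is strictly balanced: `ρ(G,H) > ρ(K,H)` for every `H ⊂ K ⊂ G`. -/
def StrictlyBalancedPair {V : Type*} (G : SimpleGraph V) (H : G.Subgraph) : Prop :=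
  ∀ K : G.Subgraph, H < K → K ≠ ⊤ → pairDensity K H < pairDensity (⊤ : G.Subgraph) H

/-- The set `E(K) \ (E(H) ∪ E(K∖H))` is non-empty: `K` has an edge, not an edge of `H`,
with at least one endpoint in `V(H)`. -/
def TouchesRoots {V : Type*} {G : SimpleGraph V} (H K : G.Subgraph) : Prop :=
  ∃ u v : V, K.Adj u v ∧ ¬H.Adj u v ∧ (u ∈ H.verts ∨ v ∈ H.verts)

/-- `e^min(G,H)` (`G` being the top subgraph). -/
noncomputable def eMin {V : Type*} {G : SimpleGraph V} (H : G.Subgraph) : ℕ :=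
  sInf {e : ℕ | ∃ K : G.Subgraph, H < K ∧ TouchesRoots H K ∧
    pairDensity K H = maxPairDensity H ∧ e = Nat.card K.edgeSet - Nat.card H.edgeSet}

/-- `f` realizes a `(G,(r 0,…,r (m-1)))`-extension of the tuple `x` in `Γ`: an injective copy
of the vertex set of `G` sending the roots to `x` and containing all edges of `E(G)∖E(H)`
as edges outside the root-induced subgraph. -/
def IsExtension {W V : Type*} (Gp : SimpleGraph W) (H : Gp.Subgraph) {m : ℕ}
    (r : Fin m → W) (Γ : SimpleGraph V) (x : Fin m → V) (f : W → V) : Prop :=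
  Function.Injective f ∧ (∀ j : Fin m, f (r j) = x j) ∧
    ∀ u v : W, Gp.Adj u v → ¬H.Adj u v →
      Γ.Adj (f u) (f v) ∧ ¬(u ∈ H.verts ∧ v ∈ H.verts)

/-- Strict extension: the implication above is an equivalence. -/
def IsStrictExtension {W V : Type*} (Gp : SimpleGraph W) (H : Gp.Subgraph) {m : ℕ}
    (r : Fin m → W) (Γ : SimpleGraph V) (x : Fin m → V) (f : W → V) : Prop :=
  Function.Injective f ∧ (∀ j : Fin m, f (r j) = x j) ∧
    ∀ u v : W, (Gp.Adj u v ∧ ¬H.Adj u v) ↔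
      (Γ.Adj (f u) (f v) ∧ ¬(u ∈ H.verts ∧ v ∈ H.verts))

/-- The pair of subgraphs of `Γ` with vertex sets `B ⊆ A` is `(K,T)`-maximal in `Γ`
(where `T ⊂ K` has roots enumerated by `s`). -/
def PairMaximal {U V : Type*} (Kp : SimpleGraph U) (T : Kp.Subgraph) {t : ℕ}
    (s : Fin t → U) (Γ : SimpleGraph V) (A B : Set V) : Prop :=
  ∀ tup : Fin t → V, Function.Injective tup → (∀ i, tup i ∈ A) → (∃ i, tup i ∉ B) →
    ¬∃ f : U → V, IsStrictExtension Kp T s Γ tup f ∧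
      (∀ u : U, f u ∈ A → f u ∈ Set.range tup) ∧
      (∀ u : U, f u ∉ Set.range tup → ∀ a ∈ A, a ∉ Set.range tup → ¬Γ.Adj (f u) a)

/-- The subgraph of `Γ` with vertex set `A` is `(K,T)`-maximal in `Γ`. -/
def GraphMaximal {U V : Type*} (Kp : SimpleGraph U) (T : Kp.Subgraph) {t : ℕ}
    (s : Fin t → U) (Γ : SimpleGraph V) (A : Set V) : Prop :=
  ∀ tup : Fin t → V, Function.Injective tup → (∀ i, tup i ∈ A) →
    ¬∃ f : U → V, IsStrictExtension Kp T s Γ tup f ∧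
      (∀ u : U, f u ∈ A → f u ∈ Set.range tup) ∧
      (∀ u : U, f u ∉ Set.range tup → ∀ a ∈ A, a ∉ Set.range tup → ¬Γ.Adj (f u) a)

/-- `Γ` contains a copy of `Gp`. -/
def ContainsCopy {W V : Type*} (Gp : SimpleGraph W) (Γ : SimpleGraph V) : Prop :=
  ∃ f : W → V, Function.Injective f ∧ ∀ u v : W, Gp.Adj u v → Γ.Adj (f u) (f v)

/-- The number of copies of `Gp` in `Γ`: subgraphs of `Γ` isomorphic to `Gp`. -/
noncomputable def numCopies {W V : Type*} (Gp : SimpleGraph W) (Γ : SimpleGraph V) : ℕ :=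
  Nat.card {H : Γ.Subgraph // Nonempty (Gp ≃g H.coe)}

/-- The matched tuples of chosen vertices induce a partial isomorphism. -/
def PartialIso {V W : Type*} (G : SimpleGraph V) (H : SimpleGraph W)
    (xs : List V) (ys : List W) : Prop :=
  ∃ h : xs.length = ys.length,
    ∀ j k : Fin xs.length,
      (xs.get j = xs.get k ↔ ys.get (Fin.cast h j) = ys.get (Fin.cast h k)) ∧
      (G.Adj (xs.get j) (xs.get k) ↔ H.Adj (ys.get (Fin.cast h j)) (ys.get (Fin.cast h k)))

/-- Duplicator has a winning strategy in the remaining `i` rounds of the Ehrenfeucht game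
on `(G,H)` from the position given by the already chosen vertices `xs`, `ys`. -/
def DuplicatorWinsFrom {V W : Type*} (G : SimpleGraph V) (H : SimpleGraph W) :
    ℕ → List V → List W → Prop
  | 0, xs, ys => PartialIso G H xs ys
  | (i + 1), xs, ys =>
      (∀ x : V, ∃ y : W, DuplicatorWinsFrom G H i (x :: xs) (y :: ys)) ∧
      (∀ y : W, ∃ x : V, DuplicatorWinsFrom G H i (x :: xs) (y :: ys))

/-- Duplicator has a winning strategy in the Ehrenfeucht game `EHR(G,H,i)`. -/
def DuplicatorWins {V W : Type*} (G : SimpleGraph V) (H : SimpleGraph W) (i : ℕ) : Prop :=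
  DuplicatorWinsFrom G H i [] []

end RandomGraphSpectra

namespace RandomGraphSpectra

/-- The class `𝒮` of graphs from Section "Properties which imply the existence of
Duplicator's winning strategy" (properties 1)–3)). -/
def GoodGraph (k b : ℕ) (α : ℝ) {V : Type*} (Γ : SimpleGraph V) : Prop :=
  -- 1) no strictly balanced subgraph with at most `2^{2k}·b` vertices and density `> 1/α`
  (∀ A : Γ.Subgraph, Nat.card A.verts ≤ 2 ^ (2 * k) * b → StrictlyBalanced A.coe →
      density A.coe ≤ 1 / α) ∧
  -- 2) strict extensions of α-safe pairs which are `(K₁,K₂)`-maximal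
  (∀ (l h : ℕ) (H₁ : SimpleGraph (Fin l)) (H₂ : H₁.Subgraph) (r : Fin h → Fin l),
      Function.Injective r → Set.range r = H₂.verts →
      l ≤ 2 ^ (2 * k) * b + k * 2 ^ k → AlphaSafe α H₁ H₂ →
      ∀ x : Fin h → V, Function.Injective x →
        ∃ f : Fin l → V, IsStrictExtension H₁ H₂ r Γ x f ∧
          ∀ (u t : ℕ) (K₁ : SimpleGraph (Fin u)) (K₂ : K₁.Subgraph) (s : Fin t → Fin u),
            Function.Injective s → Set.range s = K₂.verts →
            u ≤ 2 ^ k → Nat.card K₂.verts ≤ 2 → fAlpha α (⊤ : K₁.Subgraph) K₂ < 0 →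
            PairMaximal K₁ K₂ s Γ (Set.range f) (Set.range x)) ∧
  -- 3) maximal copies of sparse strictly balanced graphs
  (∀ (w : ℕ) (Hp : SimpleGraph (Fin w)), w ≤ 2 ^ (2 * k) * b → StrictlyBalanced Hp →
      density Hp < 1 / α →
      ∃ f : Fin w → V, Function.Injective f ∧
        (∀ u v : Fin w, Hp.Adj u v → Γ.Adj (f u) (f v)) ∧
        ∀ (u t : ℕ) (K₁ : SimpleGraph (Fin u)) (K₂ : K₁.Subgraph) (s : Fin t → Fin u),
          Function.Injective s → Set.range s = K₂.verts →
          u ≤ 2 ^ k → Nat.card K₂.verts ≤ 2 → fAlpha α (⊤ : K₁.Subgraph) K₂ < 0 →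
          GraphMaximal K₁ K₂ s Γ (Set.range f))

end RandomGraphSpectra

namespace RandomGraphSpectra

section Edges
variable {V V' : Type*}

open Classical in
/-- Edges of `G` inside a finite set `S`. -/
noncomputable def edgesIn (G : SimpleGraph V) (S : Finset V) : Finset (Sym2 V) :=
  S.sym2.filter (fun e => e ∈ G.edgeSet)

/-- Number of edges of `G` inside `S`. -/
noncomputable def eN (G : SimpleGraph V) (S : Finset V) : ℕ := (edgesIn G S).card

lemma mem_edgesIn {G : SimpleGraph V} {S : Finset V} {e : Sym2 V} :
    e ∈ edgesIn G S ↔ (∀ a ∈ e, a ∈ S) ∧ e ∈ G.edgeSet := by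
  classical
  simp [edgesIn, Finset.mem_sym2_iff]

lemma mk_mem_edgesIn {G : SimpleGraph V} {S : Finset V} {u v : V} :
    s(u, v) ∈ edgesIn G S ↔ (u ∈ S ∧ v ∈ S) ∧ G.Adj u v := by
  rw [mem_edgesIn]; simp

lemma edgesIn_mono {G : SimpleGraph V} {S T : Finset V} (h : S ⊆ T) :
    edgesIn G S ⊆ edgesIn G T := by
  intro e he
  rw [mem_edgesIn] at he ⊢
  exact ⟨fun a ha => h (he.1 a ha), he.2⟩

lemma eN_mono {G : SimpleGraph V} {S T : Finset V} (h : S ⊆ T) : eN G S ≤ eN G T :=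
  Finset.card_le_card (edgesIn_mono h)

lemma eN_empty (G : SimpleGraph V) : eN G ∅ = 0 := by
  simp [eN, edgesIn]

lemma eN_le (G : SimpleGraph V) (S : Finset V) : eN G S ≤ (S.card + 1) ^ 2 := by
  classical
  calc eN G S ≤ S.sym2.card := Finset.card_filter_le _ _
    _ = Nat.choose (S.card + 1) 2 := Finset.card_sym2 S
    _ ≤ (S.card + 1) ^ 2 := Nat.choose_le_pow _ _

variable [DecidableEq V] [DecidableEq V']

lemma edgesIn_inter (G : SimpleGraph V) (S T : Finset V) :
    edgesIn G S ∩ edgesIn G T = edgesIn G (S ∩ T) := by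
  ext e
  simp only [Finset.mem_inter, mem_edgesIn]
  constructor
  · rintro ⟨h1, h2⟩; exact ⟨fun a ha => ⟨h1.1 a ha, h2.1 a ha⟩, h1.2⟩
  · rintro ⟨h1, h2⟩; exact ⟨⟨fun a ha => (h1 a ha).1, h2⟩, ⟨fun a ha => (h1 a ha).2, h2⟩⟩

lemma eN_super (G : SimpleGraph V) (S T : Finset V) :
    eN G S + eN G T ≤ eN G (S ∪ T) + eN G (S ∩ T) := by
  unfold eN
  rw [← Finset.card_union_add_card_inter, edgesIn_inter]
  gcongr
  exact Finset.union_subset (edgesIn_mono Finset.subset_union_left)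
    (edgesIn_mono Finset.subset_union_right)

lemma eN_super_edge (G : SimpleGraph V) (S T : Finset V) {u v : V} (hu : u ∈ S) (huT : u ∉ T)
    (hv : v ∈ T) (hvS : v ∉ S) (huv : G.Adj u v) :
    eN G S + eN G T + 1 ≤ eN G (S ∪ T) + eN G (S ∩ T) := by
  unfold eN
  rw [← Finset.card_union_add_card_inter, edgesIn_inter]
  have : (edgesIn G S ∪ edgesIn G T).card < (edgesIn G (S ∪ T)).card := by
    apply Finset.card_lt_card
    refine Finset.ssubset_iff_subset_ne.2 ⟨Finset.union_subset
      (edgesIn_mono Finset.subset_union_left) (edgesIn_mono Finset.subset_union_right), ?_⟩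
    intro h
    have h1 : s(u, v) ∈ edgesIn G (S ∪ T) := by
      rw [mk_mem_edgesIn]; simp [hu, hv, huv]
    rw [← h, Finset.mem_union, mk_mem_edgesIn, mk_mem_edgesIn] at h1
    tauto
  omega

lemma eN_noedge (G : SimpleGraph V) (S T : Finset V)
    (h : ∀ u ∈ S, u ∉ T → ∀ v ∈ T, v ∉ S → ¬ G.Adj u v) :
    eN G (S ∪ T) + eN G (S ∩ T) = eN G S + eN G T := by
  unfold eN
  rw [← Finset.card_union_add_card_inter (edgesIn G S), edgesIn_inter]
  congr 2
  apply Finset.Subset.antisymm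
  · intro e
    induction e using Sym2.ind with
    | _ u v =>
      rw [Finset.mem_union, mk_mem_edgesIn, mk_mem_edgesIn, mk_mem_edgesIn]
      simp only [Finset.mem_union]
      rintro ⟨⟨h1, h2⟩, h3⟩
      have a1 := h u
      have a2 := h v
      by_contra hc
      by_cases b1 : u ∈ S <;> by_cases b2 : u ∈ T <;> by_cases b3 : v ∈ S <;>
        by_cases b4 : v ∈ T <;>
        first | exact h v b3 b4 u b2 b1 h3.symm | simp_all
  · exact Finset.union_subset (edgesIn_mono Finset.subset_union_left)
      (edgesIn_mono Finset.subset_union_right)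

lemma eN_insert (G : SimpleGraph V) (S : Finset V) {u v : V} (hu : u ∈ S) (hv : v ∉ S)
    (huv : G.Adj u v) : eN G S + 1 ≤ eN G (insert v S) := by
  apply Finset.card_lt_card
  refine Finset.ssubset_iff_subset_ne.2 ⟨edgesIn_mono (Finset.subset_insert _ _), ?_⟩
  intro h
  have h1 : s(u, v) ∈ edgesIn G (insert v S) := by
    rw [mk_mem_edgesIn]; simp [hu, huv]
  rw [← h, mk_mem_edgesIn] at h1
  tauto

/-- `φ` is an isomorphism of induced subgraphs on `A`. -/
def IsoOn (G : SimpleGraph V) (G' : SimpleGraph V') (φ : V → V') (A : Finset V) : Prop :=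
  Set.InjOn φ A ∧ ∀ u ∈ A, ∀ v ∈ A, (G.Adj u v ↔ G'.Adj (φ u) (φ v))

lemma IsoOn.mono {G : SimpleGraph V} {G' : SimpleGraph V'} {φ : V → V'} {A B : Finset V}
    (h : IsoOn G G' φ B) (hAB : A ⊆ B) : IsoOn G G' φ A :=
  ⟨h.1.mono (by exact_mod_cast hAB), fun u hu v hv => h.2 u (hAB hu) v (hAB hv)⟩

lemma sym2_map_injOn {φ : V → V'} {U : Finset V} (hφ : Set.InjOn φ U) :
    Set.InjOn (Sym2.map φ) {e : Sym2 V | ∀ a ∈ e, a ∈ U} := by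
  intro e he e' he' h
  induction e using Sym2.ind with
  | _ a b =>
    induction e' using Sym2.ind with
    | _ c d =>
      simp only [Set.mem_setOf_eq, Sym2.mem_iff, forall_eq_or_imp, forall_eq] at he he'
      simp only [Sym2.map_mk, Sym2.eq_iff] at h ⊢
      rcases h with ⟨h1, h2⟩ | ⟨h1, h2⟩
      · left; exact ⟨hφ he.1 he'.1 h1, hφ he.2 he'.2 h2⟩
      · right; exact ⟨hφ he.1 he'.2 h1, hφ he.2 he'.1 h2⟩

lemma eN_rel_image (F : SimpleGraph V) (G : SimpleGraph V') (φ : V → V') (W U : Finset V)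
    (hWU : W ⊆ U) (hφ : Set.InjOn φ U)
    (h : ∀ u ∈ U, ∀ v ∈ U, ¬ (u ∈ W ∧ v ∈ W) → F.Adj u v → G.Adj (φ u) (φ v)) :
    (edgesIn F U \ edgesIn F W).image (Sym2.map φ) ⊆
      edgesIn G (U.image φ) \ edgesIn G (W.image φ) := by
  intro e he
  rw [Finset.mem_image] at he
  obtain ⟨e', he', rfl⟩ := he
  induction e' using Sym2.ind with
  | _ u v =>
    rw [Finset.mem_sdiff, mk_mem_edgesIn, mk_mem_edgesIn] at he'
    obtain ⟨⟨⟨hu, hv⟩, huv⟩, h2⟩ := he'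
    have hW : ¬ (u ∈ W ∧ v ∈ W) := fun hc => h2 ⟨hc, huv⟩
    have h3 : ∀ x ∈ U, φ x ∈ W.image φ → x ∈ W := by
      intro x hx hxW
      rw [Finset.mem_image] at hxW
      obtain ⟨y, hy, hyx⟩ := hxW
      rwa [← hφ (hWU hy) hx hyx]
    simp only [Sym2.map_mk, Finset.mem_sdiff, mk_mem_edgesIn]
    refine ⟨⟨⟨Finset.mem_image_of_mem _ hu, Finset.mem_image_of_mem _ hv⟩, h u hu v hv hW huv⟩, ?_⟩
    rintro ⟨⟨h4, h5⟩, -⟩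
    exact hW ⟨h3 u hu h4, h3 v hv h5⟩

lemma card_rel_image (F : SimpleGraph V) (φ : V → V') (W U : Finset V)
    (hWU : W ⊆ U) (hφ : Set.InjOn φ U) :
    ((edgesIn F U \ edgesIn F W).image (Sym2.map φ)).card + eN F W = eN F U := by
  rw [Finset.card_image_of_injOn]
  · exact Finset.card_sdiff_add_card_eq_card (edgesIn_mono hWU)
  · intro e he e' he' hh
    refine sym2_map_injOn hφ ?_ ?_ hh
    · simp only [Finset.coe_sdiff, Set.mem_diff, Finset.mem_coe, mem_edgesIn] at he
      exact he.1.1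
    · simp only [Finset.coe_sdiff, Set.mem_diff, Finset.mem_coe, mem_edgesIn] at he'
      exact he'.1.1

lemma eN_rel_le (F : SimpleGraph V) (G : SimpleGraph V') (φ : V → V') (W U : Finset V)
    (hWU : W ⊆ U) (hφ : Set.InjOn φ U)
    (h : ∀ u ∈ U, ∀ v ∈ U, ¬ (u ∈ W ∧ v ∈ W) → F.Adj u v → G.Adj (φ u) (φ v)) :
    eN F U + eN G (W.image φ) ≤ eN G (U.image φ) + eN F W := by
  have h1 := Finset.card_le_card (eN_rel_image F G φ W U hWU hφ h)
  have h2 := card_rel_image F φ W U hWU hφ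
  have h3 := Finset.card_sdiff_add_card_eq_card
    (edgesIn_mono (G := G) (Finset.image_subset_image (f := φ) hWU))
  unfold eN at *
  omega

lemma eN_rel_lt (F : SimpleGraph V) (G : SimpleGraph V') (φ : V → V') (W U : Finset V)
    (hWU : W ⊆ U) (hφ : Set.InjOn φ U)
    (h : ∀ u ∈ U, ∀ v ∈ U, ¬ (u ∈ W ∧ v ∈ W) → F.Adj u v → G.Adj (φ u) (φ v))
    {a b : V} (ha : a ∈ U) (hb : b ∈ U) (hab : ¬ (a ∈ W ∧ b ∈ W)) (hF : ¬ F.Adj a b)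
    (hG : G.Adj (φ a) (φ b)) :
    eN F U + eN G (W.image φ) + 1 ≤ eN G (U.image φ) + eN F W := by
  have h0 := eN_rel_image F G φ W U hWU hφ h
  have h1 : ((edgesIn F U \ edgesIn F W).image (Sym2.map φ)).card <
      (edgesIn G (U.image φ) \ edgesIn G (W.image φ)).card := by
    apply Finset.card_lt_card
    refine Finset.ssubset_iff_subset_ne.2 ⟨h0, ?_⟩
    intro heq
    have h3 : ∀ x ∈ U, φ x ∈ W.image φ → x ∈ W := by
      intro x hx hxW
      rw [Finset.mem_image] at hxW
      obtain ⟨y, hy, hyx⟩ := hxW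
      rwa [← hφ (hWU hy) hx hyx]
    have h4 : s(φ a, φ b) ∈ edgesIn G (U.image φ) \ edgesIn G (W.image φ) := by
      rw [Finset.mem_sdiff, mk_mem_edgesIn, mk_mem_edgesIn]
      refine ⟨⟨⟨Finset.mem_image_of_mem _ ha, Finset.mem_image_of_mem _ hb⟩, hG⟩, ?_⟩
      rintro ⟨⟨h4, h5⟩, -⟩
      exact hab ⟨h3 _ ha h4, h3 _ hb h5⟩
    rw [← heq, Finset.mem_image] at h4
    obtain ⟨e, he, hee⟩ := h4
    rw [Finset.mem_sdiff, mem_edgesIn] at he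
    have : e = s(a, b) := by
      refine sym2_map_injOn hφ he.1.1 ?_ (by simpa using hee)
      simp [ha, hb]
    subst this
    exact hF (by simpa using he.1.2)
  have h2 := card_rel_image F φ W U hWU hφ
  have h3 := Finset.card_sdiff_add_card_eq_card
    (edgesIn_mono (G := G) (Finset.image_subset_image (f := φ) hWU))
  unfold eN at *
  omega

lemma IsoOn.eN_image {G : SimpleGraph V} {G' : SimpleGraph V'} {φ : V → V'} {A : Finset V}
    (h : IsoOn G G' φ A) : eN G' (A.image φ) = eN G A := by
  apply le_antisymm
  · unfold eN
    rw [← Finset.card_image_of_injOn (s := edgesIn G A) (f := Sym2.map φ)]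
    · apply Finset.card_le_card
      intro e
      induction e using Sym2.ind with
      | _ u v =>
        rw [mk_mem_edgesIn]
        simp only [Finset.mem_image]
        rintro ⟨⟨⟨a, ha, rfl⟩, ⟨b, hb, rfl⟩⟩, hab⟩
        exact ⟨s(a, b), mk_mem_edgesIn.2 ⟨⟨ha, hb⟩, (h.2 a ha b hb).2 hab⟩, by simp⟩
    · intro e he e' he' hh
      simp only [Finset.mem_coe, mem_edgesIn] at he he'
      exact sym2_map_injOn h.1 he.1 he'.1 hh
  · have := eN_rel_le G G' φ ∅ A (Finset.empty_subset _) h.1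
      (fun u hu v hv _ => (h.2 u hu v hv).1)
    simpa [eN_empty] using this

end Edges
end RandomGraphSpectra

namespace RandomGraphSpectra

section Det
variable {V V' : Type*}

/-- The weighted vertex-edge balance. -/
noncomputable def fR (α : ℝ) (G : SimpleGraph V) (S : Finset V) : ℝ := S.card - α * eN G S

/-- No small dense extension. -/
def Closed (G : SimpleGraph V) (s : ℕ) (A : Finset V) : Prop :=
  ∀ T, A ⊆ T → T.card ≤ A.card + s → eN G T + A.card ≤ eN G A + T.card

/-- No small dense extension inside `W`. -/
def ClosedIn (G : SimpleGraph V) (s : ℕ) (A W : Finset V) : Prop :=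
  ∀ T, A ⊆ T → T ⊆ W → T.card ≤ A.card + s → eN G T + A.card ≤ eN G A + T.card

/-- Safe pairs. -/
def Safe (α : ℝ) (F : SimpleGraph V) (W U : Finset V) : Prop :=
  ∀ S, W ⊆ S → S ⊆ U → S ≠ W → fR α F W < fR α F S

/-- Rigid pairs. -/
def Rigid (α : ℝ) (G : SimpleGraph V) (C T : Finset V) : Prop :=
  ∀ T1, C ⊆ T1 → T1 ⊆ T → T1 ≠ T → fR α G T < fR α G T1

/-- Rigid extensions of `C` do not attach to `C \ W`. -/
def Generic (α : ℝ) (D : ℕ) (G : SimpleGraph V) (W C : Finset V) : Prop :=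
  ∀ T, C ⊆ T → T.card ≤ C.card + D → Rigid α G C T →
    ∀ u ∈ T, u ∉ C → ∀ v ∈ C, v ∉ W → ¬ G.Adj u v

/-- `α` is not exceptional. -/
def NonExc (α : ℝ) (D : ℕ) : Prop := ∀ v e : ℕ, v ≤ D → e ≤ (D + 1) ^ 2 → v ≠ 0 → (v : ℝ) ≠ α * e

/-- No dense small subgraphs. -/
def NN (α : ℝ) (D : ℕ) (G : SimpleGraph V) : Prop := ∀ S : Finset V, S.card ≤ D → 0 ≤ fR α G S

/-- the extension property for one pattern -/
def ExtG [DecidableEq V] (α : ℝ) (D : ℕ) (G : SimpleGraph V) {t : ℕ} (F : SimpleGraph (Fin t))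
    (W U : Finset (Fin t)) : Prop :=
  ∀ g : Fin t → V, Set.InjOn g W → ∃ g' : Fin t → V, Set.InjOn g' U ∧ (∀ u ∈ W, g' u = g u) ∧
    (∀ u ∈ U, ∀ v ∈ U, ¬ (u ∈ W ∧ v ∈ W) → (F.Adj u v ↔ G.Adj (g' u) (g' v))) ∧
    Generic α D G (W.image g) (U.image g')

structure Good [DecidableEq V] (α : ℝ) (D : ℕ) (G : SimpleGraph V) : Prop where
  nn : NN α D G
  ext : ∀ t ≤ D, ∀ (F : SimpleGraph (Fin t)) (W : Finset (Fin t)), Safe α F W Finset.univ →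
    ExtG α D G F W Finset.univ

lemma Closed.mono {G : SimpleGraph V} {s s' : ℕ} {A : Finset V} (h : Closed G s A) (hs : s' ≤ s) :
    Closed G s' A := fun T h1 h2 => h T h1 (by omega)

lemma exists_closed {G : SimpleGraph V} {α : ℝ} {D s : ℕ} (hα : (s + 1) * (1 - α) ≤ (1:ℝ) / 2)
    (hα1 : α < 1) (hN : NN α D G) (X : Finset V) (q : ℕ) (hX : X.card ≤ q)
    (hq : q + s * (2 * q + 1) ≤ D) :
    ∃ A, X ⊆ A ∧ Closed G s A ∧ A.card ≤ q + s * (2 * q + 1) := by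
  have key : ∀ j ≤ 2 * q + 1, (∃ A, X ⊆ A ∧ Closed G s A ∧ A.card ≤ q + s * (2 * q + 1)) ∨
      ∃ A, X ⊆ A ∧ A.card ≤ q + s * j ∧ fR α G A ≤ q - (j : ℝ) / 2 := by
    intro j
    induction j with
    | zero =>
      intro _
      right
      refine ⟨X, subset_rfl, by omega, ?_⟩
      have : (0:ℝ) ≤ α * eN G X := by
        have : (0:ℝ) ≤ s := by positivity
        have : 0 ≤ α := by nlinarith
        positivity
      have h2 : (X.card : ℝ) ≤ q := by exact_mod_cast hX
      simp [fR]; linarith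
    | succ j ih =>
      intro hj
      rcases ih (by omega) with h | ⟨A, hXA, hA, hf⟩
      · exact Or.inl h
      by_cases hc : Closed G s A
      · left
        refine ⟨A, hXA, hc, hA.trans ?_⟩
        have : s * j ≤ s * (2 * q + 1) := Nat.mul_le_mul le_rfl (by omega)
        omega
      · right
        unfold Closed at hc
        push Not at hc
        obtain ⟨T, hAT, hT1, hT2⟩ := hc
        refine ⟨T, hXA.trans hAT, ?_, ?_⟩
        · rw [Nat.mul_succ]; omega
        · have hc := Finset.card_le_card hAT
          obtain ⟨m, hm⟩ := Nat.exists_eq_add_of_le hc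
          have h3 : eN G A + m + 1 ≤ eN G T := by omega
          have h4 : (eN G A + m + 1 : ℝ) ≤ eN G T := by exact_mod_cast h3
          have h5 : (m : ℝ) ≤ s := by exact_mod_cast (by omega : m ≤ s)
          have h6 : (T.card : ℝ) = A.card + m := by exact_mod_cast hm
          have h0 : 0 ≤ α := by
            have : (0:ℝ) ≤ s := by positivity
            nlinarith
          have h7 : α * (eN G A + m + 1 : ℝ) ≤ α * eN G T := by gcongr
          have h8 : (m + 1 : ℝ) * (1 - α) ≤ (s + 1) * (1 - α) := by
            apply mul_le_mul_of_nonneg_right <;> linarith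
          unfold fR at *
          push_cast
          rw [h6]
          nlinarith
  rcases key (2 * q + 1) le_rfl with h | ⟨A, _, h1, h2⟩
  · exact h
  · have := hN A (h1.trans hq)
    push_cast at h2
    linarith

lemma NN.sparse {G : SimpleGraph V} {α : ℝ} {D s : ℕ} (hα : (s + 1) * (1 - α) ≤ (1:ℝ) / 2)
    (hα1 : α < 1) (hN : NN α D G) (hsD : s ≤ D) {T : Finset V} (hT : T.card ≤ s) :
    eN G T ≤ T.card := by
  by_contra hc
  push Not at hc
  have h1 := hN T (hT.trans hsD)
  have h4 : (T.card + 1 : ℝ) ≤ eN G T := by exact_mod_cast hc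
  have h0 : 0 ≤ α := by
    have : (0:ℝ) ≤ s := by positivity
    nlinarith
  have h5 : (T.card : ℝ) ≤ s := by exact_mod_cast hT
  have h7 : α * (T.card + 1 : ℝ) ≤ α * eN G T := by gcongr
  have h8 : (T.card + 1 : ℝ) * (1 - α) ≤ (s + 1) * (1 - α) := by
    apply mul_le_mul_of_nonneg_right <;> linarith
  unfold fR at h1
  nlinarith

lemma closed_empty {G : SimpleGraph V} {α : ℝ} {D s : ℕ} (hα : (s + 1) * (1 - α) ≤ (1:ℝ) / 2)
    (hα1 : α < 1) (hN : NN α D G) (hsD : s ≤ D) : Closed G s ∅ := by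
  intro T _ h2
  have := hN.sparse hα hα1 hsD (T := T) (by simpa using h2)
  simp [eN_empty]; exact this

variable [DecidableEq V] [DecidableEq V']

lemma Generic.closed {G : SimpleGraph V} {α : ℝ} {D s : ℕ} (hα : (s + 1) * (1 - α) ≤ (1:ℝ) / 2)
    (hα1 : α < 1) (hsD : s ≤ D) {W C : Finset V} (hWC : W ⊆ C) (hW : Closed G s W)
    (hg : Generic α D G W C) : Closed G s C := by
  by_contra hc
  have h0 : 0 ≤ α := by
    have : (0:ℝ) ≤ s := by positivity
    nlinarith
  -- minimal violating set
  have hex : ∃ n, ∃ T, T.card = n ∧ C ⊆ T ∧ T.card ≤ C.card + s ∧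
      ¬ (eN G T + C.card ≤ eN G C + T.card) := by
    unfold Closed at hc
    push Not at hc
    obtain ⟨T, h1, h2, h3⟩ := hc
    exact ⟨_, T, rfl, h1, h2, by omega⟩
  classical
  obtain ⟨T, hTn, hCT, hTc, hTv⟩ := Nat.find_spec hex
  have hmin : ∀ T1, C ⊆ T1 → T1 ⊆ T → T1 ≠ T → eN G T1 + C.card ≤ eN G C + T1.card := by
    intro T1 h1 h2 h3
    by_contra h4
    have h5 : T1.card < T.card := Finset.card_lt_card (Finset.ssubset_iff_subset_ne.2 ⟨h2, h3⟩)
    exact Nat.find_min hex (m := T1.card) (by omega) ⟨T1, rfl, h1, by omega, h4⟩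
  have hrig : Rigid α G C T := by
    intro T1 h1 h2 h3
    have h4 := hmin T1 h1 h2 h3
    have hc1 := Finset.card_le_card h2
    have hc2 := Finset.card_le_card h1
    obtain ⟨m, hm⟩ := Nat.exists_eq_add_of_le hc1
    have h5 : eN G T1 + m + 1 ≤ eN G T := by omega
    have h4 : (eN G T1 + m + 1 : ℝ) ≤ eN G T := by exact_mod_cast h5
    have h5 : (m : ℝ) ≤ s := by exact_mod_cast (by omega : m ≤ s)
    have h6 : (T.card : ℝ) = T1.card + m := by exact_mod_cast hm
    have h7 : α * (eN G T1 + m + 1 : ℝ) ≤ α * eN G T := by gcongr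
    have h8 : (m + 1 : ℝ) * (1 - α) ≤ (s + 1) * (1 - α) := by
      apply mul_le_mul_of_nonneg_right <;> linarith
    unfold fR
    rw [h6]
    nlinarith
  have hno := hg T hCT (by omega) hrig
  have hE := eN_noedge G (W ∪ (T \ C)) C (by
    intro u hu huC v hv hvW
    refine hno u ?_ huC v hv ?_
    · simp only [Finset.mem_union, Finset.mem_sdiff] at hu
      rcases hu with hu | hu
      · exact hCT (hWC hu)
      · exact hu.1
    · simp only [Finset.mem_union] at hvW
      tauto)
  have e1 : W ∪ T \ C ∪ C = T := by
    ext a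
    have := @hWC a
    have := @hCT a
    simp only [Finset.mem_union, Finset.mem_sdiff]; tauto
  have e2 : (W ∪ T \ C) ∩ C = W := by
    ext a
    have := @hWC a
    simp only [Finset.mem_union, Finset.mem_sdiff, Finset.mem_inter]; tauto
  rw [e1, e2] at hE
  have e3 : (W ∪ T \ C).card = W.card + (T.card - C.card) := by
    rw [Finset.card_union_of_disjoint, Finset.card_sdiff_of_subset hCT]
    rw [Finset.disjoint_left]
    intro a ha; simp [hWC ha]
  have := hW (W ∪ T \ C) Finset.subset_union_left (by omega)
  have := Finset.card_le_card hCT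
  omega

lemma Generic.strong {G : SimpleGraph V} {α : ℝ} {D : ℕ} (hN : NN α D G) {C : Finset V}
    (hg : Generic α D G ∅ C) {T : Finset V} (hCT : C ⊆ T) (hT : T.card ≤ C.card + D) :
    fR α G C ≤ fR α G T := by
  by_contra hc
  push Not at hc
  -- minimal set
  have hex : ∃ n, ∃ T0, T0.card = n ∧ C ⊆ T0 ∧ T0 ⊆ T ∧
      ∀ T1, C ⊆ T1 → T1 ⊆ T → fR α G T0 ≤ fR α G T1 := by
    obtain ⟨T0, h1, h2⟩ := Finset.exists_min_image (T.powerset.filter (C ⊆ ·)) (fR α G)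
      ⟨T, by simp [hCT]⟩
    simp only [Finset.mem_filter, Finset.mem_powerset] at h1 h2
    exact ⟨_, T0, rfl, h1.2, h1.1, fun T1 h3 h4 => h2 T1 ⟨h4, h3⟩⟩
  classical
  obtain ⟨T0, hTn, hC0, h0T, hmin⟩ := Nat.find_spec hex
  have hrig : Rigid α G C T0 := by
    intro T1 h1 h2 h3
    refine lt_of_le_of_ne (hmin T1 h1 (h2.trans h0T)) ?_
    intro heq
    have h5 : T1.card < T0.card := Finset.card_lt_card (Finset.ssubset_iff_subset_ne.2 ⟨h2, h3⟩)
    exact Nat.find_min hex (m := T1.card) (by omega)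
      ⟨T1, rfl, h1, h2.trans h0T, fun T2 h6 h7 => heq ▸ hmin T2 h6 h7⟩
  have hcT := Finset.card_le_card h0T
  have hno := hg T0 hC0 (by omega) hrig
  have hE := eN_noedge G (T0 \ C) C (by
    intro u hu huC v hv hvW
    simp only [Finset.mem_sdiff] at hu
    exact hno u hu.1 huC v hv (by simp))
  have e1 : T0 \ C ∪ C = T0 := Finset.sdiff_union_of_subset hC0
  rw [e1, Finset.sdiff_inter_self, eN_empty] at hE
  have e3 : (T0 \ C).card = T0.card - C.card := Finset.card_sdiff_of_subset hC0
  have hc0 := Finset.card_le_card hC0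
  have h9 := hN (T0 \ C) (by omega)
  have h10 := hmin T hCT subset_rfl
  unfold fR at *
  rw [e3, Nat.cast_sub hc0] at h9
  have : (eN G T0 : ℝ) = eN G (T0 \ C) + eN G C := by exact_mod_cast hE
  rw [this] at h10
  linarith

lemma Closed.trans {G : SimpleGraph V} {s : ℕ} {A W : Finset V} (hAW : A ⊆ W)
    (h : ClosedIn G s A W) (hW : Closed G s W) : Closed G s A := by
  intro T hAT hT
  have h1 := h (T ∩ W) (Finset.subset_inter hAT hAW) Finset.inter_subset_right
    ((Finset.card_le_card Finset.inter_subset_left).trans hT)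
  have h3 := Finset.card_union_add_card_inter T W
  have h4 := Finset.card_le_card (Finset.subset_inter hAT hAW)
  have h2 := hW (T ∪ W) Finset.subset_union_right (by omega)
  have h5 := eN_super G T W
  omega

lemma Closed.image_in {G : SimpleGraph V} {G' : SimpleGraph V'} {s : ℕ} {A W : Finset V}
    {φ : V → V'} (hφ : IsoOn G G' φ W) (hAW : A ⊆ W) (hA : Closed G s A) :
    ClosedIn G' s (A.image φ) (W.image φ) := by
  intro T hAT hTW hT
  obtain ⟨T0, hT0W, rfl⟩ := Finset.subset_image_iff.1 hTW
  have hT0W : T0 ⊆ W := by exact_mod_cast hT0W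
  have hsub : A ⊆ T0 := by
    intro a ha
    have := hAT (Finset.mem_image_of_mem φ ha)
    obtain ⟨b, hb, hba⟩ := Finset.mem_image.1 this
    rwa [← hφ.1 (hT0W hb) (hAW ha) hba]
  have c1 := Finset.card_image_of_injOn (hφ.mono hT0W).1
  have c2 := Finset.card_image_of_injOn (hφ.mono hAW).1
  have e1 := (hφ.mono hT0W).eN_image
  have e2 := (hφ.mono hAW).eN_image
  have := hA T0 hsub (by omega)
  omega

/-- bounded distance -/
def Reach (G : SimpleGraph V) : ℕ → V → V → Prop
  | 0, x, y => x = y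
  | d + 1, x, y => Reach G d x y ∨ ∃ w, Reach G d x w ∧ G.Adj w y

lemma Reach.self (G : SimpleGraph V) (d : ℕ) (x : V) : Reach G d x x := by
  induction d with
  | zero => rfl
  | succ d ih => exact Or.inl ih

lemma Reach.mono {G : SimpleGraph V} {d d' : ℕ} (h : d ≤ d') {x y : V} (hr : Reach G d x y) :
    Reach G d' x y := by
  induction h with
  | refl => exact hr
  | step _ ih => exact Or.inl ih

lemma Reach.trans {G : SimpleGraph V} {d d' : ℕ} {x y z : V} (h : Reach G d x y)
    (h' : Reach G d' y z) : Reach G (d + d') x z := by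
  induction d' generalizing z with
  | zero => cases h'; exact h
  | succ n ih =>
    rcases h' with h' | ⟨w, h1, h2⟩
    · exact Or.inl (ih h')
    · exact Or.inr ⟨w, ih h1, h2⟩

lemma Reach.adj {G : SimpleGraph V} {x y : V} (h : G.Adj x y) : Reach G 1 x y :=
  Or.inr ⟨x, rfl, h⟩

lemma Reach.symm {G : SimpleGraph V} {d : ℕ} {x y : V} (h : Reach G d x y) : Reach G d y x := by
  induction d generalizing y with
  | zero => exact Eq.symm h
  | succ n ih =>
    rcases h with h | ⟨w, h1, h2⟩
    · exact Or.inl (ih h)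
    · have := (Reach.adj h2.symm).trans (ih h1)
      rwa [add_comm] at this

lemma near {G : SimpleGraph V} (G' : SimpleGraph V') {A : Finset V} {x z : V} (hx : x ∈ A)
    {d : ℕ} (h : Reach G d x z) : ∃ B, A ⊆ B ∧ B.card ≤ A.card + d ∧
      eN G A + B.card ≤ eN G B + A.card ∧ z ∈ B ∧
      ∀ φ : V → V', IsoOn G G' φ B → Reach G' d (φ x) (φ z) := by
  induction d generalizing z with
  | zero =>
    cases h
    exact ⟨A, subset_rfl, le_rfl, le_rfl, hx, fun φ _ => rfl⟩
  | succ d ih =>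
    rcases h with h | ⟨w, h1, h2⟩
    · obtain ⟨B, a1, a2, a3, a4, a5⟩ := ih h
      exact ⟨B, a1, by omega, a3, a4, fun φ hφ => Or.inl (a5 φ hφ)⟩
    · obtain ⟨B, a1, a2, a3, a4, a5⟩ := ih h1
      by_cases hz : z ∈ B
      · exact ⟨B, a1, by omega, a3, hz,
          fun φ hφ => Or.inr ⟨φ w, a5 φ hφ, (hφ.2 w a4 z hz).1 h2⟩⟩
      · have := eN_insert G B a4 hz h2
        have hc := Finset.card_insert_of_notMem hz
        refine ⟨insert z B, a1.trans (Finset.subset_insert _ _), by omega, by omega,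
          Finset.mem_insert_self _ _, fun φ hφ => Or.inr ⟨φ w, ?_, ?_⟩⟩
        · exact a5 φ (hφ.mono (Finset.subset_insert _ _))
        · exact (hφ.2 w (Finset.mem_insert_of_mem a4) z (Finset.mem_insert_self _ _)).1 h2

lemma far {G : SimpleGraph V} {s : ℕ} {R A : Finset V} (hdis : Disjoint R A)
    (hno : ∀ u ∈ R, ∀ v ∈ A, ¬ G.Adj u v) (hC : Closed G s (R ∪ A)) {d : ℕ} (hd : d ≤ s + 1)
    {r a : V} (hr : r ∈ R) (ha : a ∈ A) : ¬ Reach G d r a := by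
  have key : ∀ d v, Reach G d r v →
      (∃ B, R ⊆ B ∧ Disjoint B A ∧ v ∈ B ∧ B.card ≤ R.card + d ∧
        eN G R + B.card ≤ eN G B + R.card) ∨
      (∃ B, R ⊆ B ∧ Disjoint B A ∧ B.card + 1 ≤ R.card + d ∧
        eN G R + B.card ≤ eN G B + R.card ∧ ∃ u ∈ B, ∃ v ∈ A, G.Adj u v) := by
    intro d
    induction d with
    | zero =>
      intro v hv
      cases hv
      exact Or.inl ⟨R, subset_rfl, hdis, hr, le_rfl, le_rfl⟩
    | succ d ih =>
      rintro v (hv | ⟨w, h1, h2⟩)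
      · rcases ih v hv with ⟨B, a1, a2, a3, a4, a5⟩ | ⟨B, a1, a2, a3, a4, a5⟩
        · exact Or.inl ⟨B, a1, a2, a3, by omega, a5⟩
        · exact Or.inr ⟨B, a1, a2, by omega, a4, a5⟩
      · rcases ih w h1 with ⟨B, a1, a2, a3, a4, a5⟩ | ⟨B, a1, a2, a3, a4, a5⟩
        · by_cases hvA : v ∈ A
          · exact Or.inr ⟨B, a1, a2, by omega, a5, w, a3, v, hvA, h2⟩
          · left
            by_cases hvB : v ∈ B
            · exact ⟨B, a1, a2, hvB, by omega, a5⟩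
            · have := eN_insert G B a3 hvB h2
              have hc := Finset.card_insert_of_notMem hvB
              refine ⟨insert v B, a1.trans (Finset.subset_insert _ _), ?_,
                Finset.mem_insert_self _ _, by omega, by omega⟩
              rw [Finset.disjoint_insert_left]
              exact ⟨hvA, a2⟩
        · exact Or.inr ⟨B, a1, a2, by omega, a4, a5⟩
  intro hra
  rcases key d a hra with ⟨B, a1, a2, a3, a4, a5⟩ | ⟨B, a1, a2, a3, a4, u, hu, v, hv, huv⟩
  · exact Finset.disjoint_left.1 a2 a3 ha
  · have h1 := eN_super_edge G B A hu (Finset.disjoint_left.1 a2 hu) hv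
      (Finset.disjoint_right.1 a2 hv) huv
    rw [Finset.disjoint_iff_inter_eq_empty.1 a2, eN_empty] at h1
    have h2 := eN_noedge G R A (fun u hu _ v hv _ => hno u hu v hv)
    rw [Finset.disjoint_iff_inter_eq_empty.1 hdis, eN_empty] at h2
    have h3 := Finset.card_union_of_disjoint hdis
    have h4 := Finset.card_union_of_disjoint a2
    have h5 := hC (B ∪ A) (Finset.union_subset_union_left a1) (by omega)
    omega

lemma far_closed {G : SimpleGraph V} {α : ℝ} {D s : ℕ} (hα : (s + 1) * (1 - α) ≤ (1:ℝ) / 2)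
    (hα1 : α < 1) (hN : NN α D G) (hsD : s ≤ D) {R A : Finset V} (hdis : Disjoint R A)
    (hno : ∀ u ∈ R, ∀ v ∈ A, ¬ G.Adj u v) (hC : Closed G s (R ∪ A)) : Closed G s A := by
  refine Closed.trans Finset.subset_union_right ?_ hC
  intro T hAT hTU hT
  have h0 : (T \ A).card = T.card - A.card := Finset.card_sdiff_of_subset hAT
  have h1 := hN.sparse hα hα1 hsD (T := T \ A) (by omega)
  have h2 := eN_noedge G (T \ A) A (by
    intro u hu huA v hv _
    rw [Finset.mem_sdiff] at hu
    have := hTU hu.1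
    rw [Finset.mem_union] at this
    exact hno u (this.resolve_right huA) v hv)
  rw [Finset.sdiff_union_of_subset hAT, Finset.sdiff_inter_self, eN_empty] at h2
  have := Finset.card_le_card hAT
  omega

end Det
end RandomGraphSpectra

namespace RandomGraphSpectra

section Ext
variable {V V' : Type*} [DecidableEq V] [DecidableEq V']

lemma IsoOn.fR_image {α : ℝ} {G : SimpleGraph V} {G' : SimpleGraph V'} {φ : V → V'} {A : Finset V}
    (h : IsoOn G G' φ A) : fR α G' (A.image φ) = fR α G A := by
  unfold fR
  rw [h.eN_image, Finset.card_image_of_injOn h.1]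

/-- coordinate free extension property -/
lemma Good.extend {α : ℝ} {D : ℕ} {G' : SimpleGraph V'} (hG : Good α D G') (G : SimpleGraph V)
    {A B : Finset V} (hAB : A ⊆ B) (hB : B.card ≤ D) (hs : Safe α G A B) (φ : V → V')
    (hφ : Set.InjOn φ A) :
    ∃ ψ : V → V', Set.InjOn ψ B ∧ (∀ u ∈ A, ψ u = φ u) ∧
      (∀ u ∈ B, ∀ v ∈ B, ¬ (u ∈ A ∧ v ∈ A) → (G.Adj u v ↔ G'.Adj (ψ u) (ψ v))) ∧
      Generic α D G' (A.image φ) (B.image ψ) := by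
  classical
  set e := B.equivFin with he
  let i : Fin B.card → V := fun j => (e.symm j : V)
  have hi : Function.Injective i := fun a b h => e.symm.injective (Subtype.ext h)
  have hiB : ∀ j, i j ∈ B := fun j => (e.symm j).2
  have hie : ∀ u (hu : u ∈ B), i (e ⟨u, hu⟩) = u := by
    intro u hu; simp [i]
  let F : SimpleGraph (Fin B.card) := G.comap i
  let W : Finset (Fin B.card) := Finset.univ.filter (fun j => i j ∈ A)
  have hiso : IsoOn F G i Finset.univ := ⟨hi.injOn, fun u _ v _ => Iff.rfl⟩
  have hWim : W.image i = A := by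
    ext a
    simp only [W, Finset.mem_image, Finset.mem_filter, Finset.mem_univ, true_and]
    constructor
    · rintro ⟨j, hj, rfl⟩; exact hj
    · intro ha
      exact ⟨e ⟨a, hAB ha⟩, by rw [hie]; exact ha, hie _ _⟩
  have hsafe : Safe α F W Finset.univ := by
    intro S hWS _ hne
    rw [← (hiso.mono (Finset.subset_univ W)).fR_image, ← (hiso.mono (Finset.subset_univ S)).fR_image,
      hWim]
    apply hs
    · rw [← hWim]; exact Finset.image_subset_image hWS
    · intro a ha
      obtain ⟨j, _, rfl⟩ := Finset.mem_image.1 ha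
      exact hiB j
    · intro h
      apply hne
      rw [← hWim] at h
      exact Finset.image_injective hi h
  obtain ⟨g, h1, h2, h3, h4⟩ := hG.ext _ hB F W hsafe (φ ∘ i) (by
    intro a ha b hb hab
    simp only [W, Finset.coe_filter, Finset.mem_univ, true_and, Set.mem_setOf_eq] at ha hb
    exact hi (hφ ha hb hab))
  let ψ : V → V' := fun u => if hu : u ∈ B then g (e ⟨u, hu⟩) else φ u
  have hψ : ∀ u (hu : u ∈ B), ψ u = g (e ⟨u, hu⟩) := fun u hu => dif_pos hu
  have hW : ∀ u (hu : u ∈ B), e ⟨u, hu⟩ ∈ W ↔ u ∈ A := by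
    intro u hu; simp [W, hie]
  have hBim : B.image ψ = Finset.univ.image g := by
    ext a
    simp only [Finset.mem_image, Finset.mem_univ, true_and]
    constructor
    · rintro ⟨u, hu, rfl⟩; exact ⟨_, (hψ u hu).symm⟩
    · rintro ⟨j, rfl⟩
      refine ⟨i j, hiB j, ?_⟩
      rw [hψ _ (hiB j)]; simp [i]
  refine ⟨ψ, ?_, ?_, ?_, ?_⟩
  · intro u hu v hv huv
    rw [hψ u hu, hψ v hv] at huv
    have := h1 (by simp) (by simp) huv
    simpa using this
  · intro u hu
    rw [hψ u (hAB hu), h2 _ ((hW _ _).2 hu)]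
    simp [hie]
  · intro u hu v hv huv
    rw [hψ u hu, hψ v hv, ← h3 _ (by simp) _ (by simp) (by rw [hW, hW]; exact huv)]
    simp [F, hie]
  · rw [hBim]
    have : A.image φ = W.image (φ ∘ i) := by rw [← hWim, Finset.image_image]
    rw [this]; exact h4

lemma Good.extend_iso {α : ℝ} {D : ℕ} {G' : SimpleGraph V'} (hG : Good α D G') (G : SimpleGraph V)
    {A B : Finset V} (hAB : A ⊆ B) (hB : B.card ≤ D) (hs : Safe α G A B) (φ : V → V')
    (hφ : IsoOn G G' φ A) :
    ∃ ψ : V → V', IsoOn G G' ψ B ∧ (∀ u ∈ A, ψ u = φ u) ∧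
      Generic α D G' (A.image φ) (B.image ψ) := by
  obtain ⟨ψ, h1, h2, h3, h4⟩ := hG.extend G hAB hB hs φ hφ.1
  refine ⟨ψ, ⟨h1, fun u hu v hv => ?_⟩, h2, h4⟩
  by_cases h : u ∈ A ∧ v ∈ A
  · rw [h2 u h.1, h2 v h.2]; exact hφ.2 u h.1 v h.2
  · exact h3 u hu v hv h

lemma safe_of_le {α : ℝ} {D : ℕ} (hne : NonExc α D) {G : SimpleGraph V} {A B : Finset V}
    (hB : B.card ≤ D) (h : ∀ S, A ⊆ S → S ⊆ B → fR α G A ≤ fR α G S) : Safe α G A B := by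
  intro S h1 h2 h3
  refine lt_of_le_of_ne (h S h1 h2) ?_
  intro heq
  have hc := Finset.card_lt_card (Finset.ssubset_iff_subset_ne.2 ⟨h1, h3.symm⟩)
  have hcB := Finset.card_le_card h2
  have hm := eN_mono (G := G) h1
  have hle := eN_le G S
  have hle2 : eN G S ≤ (D + 1) ^ 2 := hle.trans (Nat.pow_le_pow_left (by omega) _)
  refine hne (S.card - A.card) (eN G S - eN G A) (by omega) (by omega) (by omega) ?_
  rw [Nat.cast_sub hc.le, Nat.cast_sub hm]
  unfold fR at heq
  linarith

lemma safe_empty {α : ℝ} {D : ℕ} (hne : NonExc α D) {G : SimpleGraph V} (hN : NN α D G)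
    {B : Finset V} (hB : B.card ≤ D) : Safe α G ∅ B := by
  apply safe_of_le hne hB
  intro S _ h2
  have := hN S ((Finset.card_le_card h2).trans hB)
  simpa [fR, eN_empty] using this

lemma safe_near {α : ℝ} (hα0 : 0 < α) (hα1 : α < 1) {G : SimpleGraph V} {A B : Finset V} {s : ℕ}
    (hA : Closed G s A) (hc : B.card ≤ A.card + s) : Safe α G A B := by
  intro S h1 h2 h3
  have hc1 := Finset.card_lt_card (Finset.ssubset_iff_subset_ne.2 ⟨h1, h3.symm⟩)
  have hc2 := Finset.card_le_card h2
  have h4 := hA S h1 (by omega)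
  obtain ⟨m, hm⟩ := Nat.exists_eq_add_of_lt hc1
  have h5 : (eN G S : ℝ) ≤ eN G A + m + 1 := by exact_mod_cast (by omega : eN G S ≤ eN G A + m + 1)
  have h6 : (S.card : ℝ) = A.card + m + 1 := by exact_mod_cast hm
  have h7 : α * eN G S ≤ α * (eN G A + m + 1) := by gcongr
  have : (0:ℝ) ≤ m := by positivity
  unfold fR
  rw [h6]
  nlinarith

/-- extension of closed sets to a far away disjoint copy -/
lemma Good.far_copy [Nonempty V'] {α : ℝ} {D s : ℕ} (hα : (s + 1) * (1 - α) ≤ (1:ℝ) / 2)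
    (hα1 : α < 1) (hsD : s ≤ D) (hne : NonExc α D)
    {G : SimpleGraph V} {G' : SimpleGraph V'} (hN : NN α D G) (hG' : Good α D G')
    {A : Finset V} {R : Finset V'} (hcard : A.card + R.card ≤ D) (hR : Closed G' s R) :
    ∃ ψ : V → V', IsoOn G G' ψ A ∧ Closed G' s (A.image ψ) ∧
      ∀ d ≤ s + 1, ∀ r ∈ R, ∀ a ∈ A, ¬ Reach G' d r (ψ a) := by
  classical
  let P : SimpleGraph (V ⊕ V') := G ⊕g G'
  let rt : Finset (V ⊕ V') := R.image Sum.inr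
  let al : Finset (V ⊕ V') := A.image Sum.inl
  have hdis : Disjoint al rt := by
    rw [Finset.disjoint_left]
    intro a ha hb
    obtain ⟨u, _, rfl⟩ := Finset.mem_image.1 ha
    obtain ⟨v, _, hv⟩ := Finset.mem_image.1 hb
    cases hv
  have hal : al.card = A.card := Finset.card_image_of_injective _ Sum.inl_injective
  have hrt : rt.card = R.card := Finset.card_image_of_injective _ Sum.inr_injective
  have hcB : (al ∪ rt).card ≤ D := by
    rw [Finset.card_union_of_disjoint hdis]; omega
  have hsafe : Safe α P rt (al ∪ rt) := by
    apply safe_of_le hne hcB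
    intro S h1 h2
    have hS : S \ rt ⊆ al := by
      intro a ha
      rw [Finset.mem_sdiff] at ha
      exact (Finset.mem_union.1 (h2 ha.1)).resolve_right ha.2
    obtain ⟨S0, hS0, hS0'⟩ := Finset.subset_image_iff.1 hS
    have hE := eN_noedge P (S \ rt) rt (by
      intro u hu _ v hv _
      rw [← hS0'] at hu
      obtain ⟨a, _, rfl⟩ := Finset.mem_image.1 hu
      obtain ⟨b, _, rfl⟩ := Finset.mem_image.1 hv
      simp [P])
    rw [Finset.sdiff_union_of_subset h1, Finset.sdiff_inter_self, eN_empty] at hE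
    have hiso : IsoOn G P Sum.inl S0 := ⟨Sum.inl_injective.injOn, by simp [P]⟩
    have h3 := hN S0 (by
      have : S0.card ≤ A.card := Finset.card_le_card (by exact_mod_cast hS0)
      omega)
    rw [← hiso.fR_image, hS0'] at h3
    have h4 := Finset.card_sdiff_of_subset h1
    have h5 := Finset.card_le_card h1
    unfold fR at *
    rw [h4, Nat.cast_sub h5] at h3
    have : (eN P S : ℝ) = eN P (S \ rt) + eN P rt := by exact_mod_cast hE
    rw [this]; linarith
  obtain ⟨v0⟩ := ‹Nonempty V'›
  obtain ⟨ψ, h1, h2, h3⟩ := hG'.extend_iso P Finset.subset_union_right hcB hsafe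
    (Sum.elim (fun _ => v0) id) ⟨by
      intro a ha b hb hab
      obtain ⟨u, _, rfl⟩ := Finset.mem_image.1 ha
      obtain ⟨v, _, rfl⟩ := Finset.mem_image.1 hb
      simpa using hab, by
      intro a ha b hb
      obtain ⟨u, _, rfl⟩ := Finset.mem_image.1 ha
      obtain ⟨v, _, rfl⟩ := Finset.mem_image.1 hb
      simp [P]⟩
  have e1 : rt.image (Sum.elim (fun _ => v0) id) = R := by
    simp [rt, Finset.image_image, Function.comp_def]
  have e2 : (al ∪ rt).image ψ = R ∪ A.image (ψ ∘ Sum.inl) := by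
    rw [Finset.image_union, Finset.union_comm]
    congr 1
    · rw [← e1]
      apply Finset.image_congr
      intro a ha
      exact h2 a ha
    · simp [al, Finset.image_image]
  rw [e1, e2] at h3
  have hcl := h3.closed hα hα1 hsD Finset.subset_union_left hR
  have hRψ : ∀ r ∈ R, ψ (Sum.inr r) = r := by
    intro r hr
    rw [h2 _ (Finset.mem_image_of_mem _ hr)]; simp
  have hdis' : Disjoint R (A.image (ψ ∘ Sum.inl)) := by
    rw [Finset.disjoint_left]
    intro r hr hr'
    obtain ⟨a, ha, hra⟩ := Finset.mem_image.1 hr'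
    rw [← hRψ r hr] at hra
    have := h1.1 (by simp [al, ha]) (by simp [rt, hr]) hra
    cases this
  have hno : ∀ u ∈ R, ∀ v ∈ A.image (ψ ∘ Sum.inl), ¬ G'.Adj u v := by
    intro r hr v hv
    obtain ⟨a, ha, rfl⟩ := Finset.mem_image.1 hv
    rw [← hRψ r hr, Function.comp_apply, ← h1.2 _ (by simp [rt, hr]) _ (by simp [al, ha])]
    simp [P]
  refine ⟨ψ ∘ Sum.inl, ⟨?_, ?_⟩, far_closed hα hα1 hG'.nn hsD hdis' hno hcl, ?_⟩
  · intro a ha b hb hab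
    have := h1.1 (by simp [al, Finset.mem_coe.1 ha]) (by simp [al, Finset.mem_coe.1 hb]) hab
    exact Sum.inl_injective this
  · intro a ha b hb
    rw [Function.comp_apply, Function.comp_apply, ← h1.2 _ (by simp [al, ha]) _ (by simp [al, hb])]
    simp [P]
  · intro d hd r hr a ha
    exact far hdis' hno hcl hd hr (Finset.mem_image_of_mem _ ha)

end Ext
end RandomGraphSpectra

namespace RandomGraphSpectra

section Game
variable {V V' : Type*}

/-- tuples satisfying the same atomic formulas -/
def Atomic (G : SimpleGraph V) (G' : SimpleGraph V') {r : ℕ} (x : Fin r → V) (y : Fin r → V') :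
    Prop :=
  ∀ j l, (x j = x l ↔ y j = y l) ∧ (G.Adj (x j) (x l) ↔ G'.Adj (y j) (y l))

/-- back-and-forth equivalence -/
def EqI (G : SimpleGraph V) (G' : SimpleGraph V') :
    ℕ → ∀ {r : ℕ}, (Fin r → V) → (Fin r → V') → Prop
  | 0, _, x, y => Atomic G G' x y
  | i + 1, r, x, y => Atomic G G' x y ∧
      (∀ z, ∃ z', EqI G G' i (r := r + 1) (Fin.snoc x z) (Fin.snoc y z')) ∧
      (∀ z', ∃ z, EqI G G' i (r := r + 1) (Fin.snoc x z) (Fin.snoc y z'))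

lemma EqI.atomic {G : SimpleGraph V} {G' : SimpleGraph V'} {i r : ℕ} {x : Fin r → V}
    {y : Fin r → V'} (h : EqI G G' i x y) : Atomic G G' x y := by
  cases i with
  | zero => exact h
  | succ i => exact h.1

lemma EqI.realize {G : SimpleGraph V} {G' : SimpleGraph V'} {r : ℕ}
    (φ : Language.graph.BoundedFormula Empty r) : ∀ {i : ℕ} {x : Fin r → V}
    {y : Fin r → V'}, EqI G G' i x y → qDepth φ ≤ i →
    ∀ (v : Empty → V) (v' : Empty → V'),
    (@Language.BoundedFormula.Realize Language.graph V G.structure Empty r φ v x ↔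
     @Language.BoundedFormula.Realize Language.graph V' G'.structure Empty r φ v' y) := by
  letI := G.structure
  letI := G'.structure
  have term : ∀ {r : ℕ} (t : Language.graph.Term (Empty ⊕ Fin r)), ∃ j,
      t = Language.Term.var (Sum.inr j) := by
    intro r t
    cases t with
    | var a =>
      rcases a with a | a
      · exact a.elim
      · exact ⟨a, rfl⟩
    | func f _ => cases f
  induction φ with
  | falsum => intro i x y h hq v v'; rfl
  | equal t₁ t₂ =>
    intro i x y h hq v v'
    obtain ⟨j, rfl⟩ := term t₁
    obtain ⟨l, rfl⟩ := term t₂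
    simp only [Language.BoundedFormula.Realize, Language.Term.realize_var, Sum.elim_inr]
    exact (h.atomic j l).1
  | rel R ts =>
    intro i x y h hq v v'
    cases R
    obtain ⟨j, hj⟩ := term (ts 0)
    obtain ⟨l, hl⟩ := term (ts 1)
    have := (h.atomic j l).2
    simp only [Language.BoundedFormula.Realize]
    change G.Adj _ _ ↔ G'.Adj _ _
    simpa [hj, hl] using this
  | imp f g ihf ihg =>
    intro i x y h hq v v'
    simp only [qDepth, max_le_iff] at hq
    simp only [Language.BoundedFormula.Realize]
    rw [ihf h hq.1 v v', ihg h hq.2 v v']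
  | all f ih =>
    intro i x y h hq v v'
    simp only [qDepth] at hq
    obtain ⟨i, rfl⟩ : ∃ i', i = i' + 1 := ⟨i - 1, by omega⟩
    obtain ⟨_, h1, h2⟩ := h
    simp only [Language.BoundedFormula.Realize]
    constructor
    · intro H z'
      obtain ⟨z, hz⟩ := h2 z'
      exact (ih hz (by omega) v v').1 (H z)
    · intro H z
      obtain ⟨z', hz⟩ := h1 z
      exact (ih hz (by omega) v v').2 (H z')

lemma EqI.graphSat {G : SimpleGraph V} {G' : SimpleGraph V'} {k : ℕ}
    (h : ∀ (x : Fin 0 → V) (y : Fin 0 → V'), EqI G G' k x y) (φ : Language.graph.Sentence)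
    (hφ : qDepth φ ≤ k) : GraphSat G φ ↔ GraphSat G' φ :=
  EqI.realize φ (h _ _) hφ _ _

variable [DecidableEq V] [DecidableEq V']

def Inv (G : SimpleGraph V) (G' : SimpleGraph V') (D i : ℕ) {r : ℕ} (x : Fin r → V)
    (y : Fin r → V') : Prop :=
  ∃ (c : Fin r → ℕ) (A : ℕ → Finset V) (φ : ℕ → V → V'),
    (∀ j, x j ∈ A (c j) ∧ y j = φ (c j) (x j) ∧ IsoOn G G' (φ (c j)) (A (c j)) ∧
      Closed G (2 ^ i - 1) (A (c j)) ∧ Closed G' (2 ^ i - 1) ((A (c j)).image (φ (c j))) ∧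
      (A (c j)).card + 2 ^ i ≤ D) ∧
    ∀ j l, c j ≠ c l → ¬ Reach G (2 ^ i) (x j) (x l) ∧ ¬ Reach G' (2 ^ i) (y j) (y l)

lemma Inv.atomic {G : SimpleGraph V} {G' : SimpleGraph V'} {D i r : ℕ} {x : Fin r → V}
    {y : Fin r → V'} (h : Inv G G' D i x y) : Atomic G G' x y := by
  obtain ⟨c, A, φ, h1, h2⟩ := h
  intro j l
  by_cases hc : c j = c l
  · obtain ⟨a1, a2, a3, -⟩ := h1 j
    obtain ⟨b1, b2, -⟩ := h1 l
    rw [a2, b2]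
    rw [← hc] at b1 ⊢
    exact ⟨⟨fun h => by rw [h], fun h => a3.1 a1 b1 h⟩, a3.2 _ a1 _ b1⟩
  · obtain ⟨a, b⟩ := h2 j l hc
    have hp : 1 ≤ 2 ^ i := Nat.one_le_two_pow
    refine ⟨⟨fun h => ?_, fun h => ?_⟩, ⟨fun h => ?_, fun h => ?_⟩⟩
    · exact absurd (h ▸ Reach.self G _ _) a
    · exact absurd (h ▸ Reach.self G' _ _) b
    · exact absurd ((Reach.adj h).mono hp) a
    · exact absurd ((Reach.adj h).mono hp) b

lemma IsoOn.symm [Nonempty V] {G : SimpleGraph V} {G' : SimpleGraph V'} {φ : V → V'} {A : Finset V}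
    (h : IsoOn G G' φ A) : ∃ ψ : V' → V, (∀ a ∈ A, ψ (φ a) = a) ∧ IsoOn G' G ψ (A.image φ) ∧
      (A.image φ).image ψ = A := by
  have key : ∀ a ∈ A, Function.invFunOn φ (A : Set V) (φ a) = a :=
    fun a ha => h.1.leftInvOn_invFunOn ha
  refine ⟨Function.invFunOn φ (A : Set V), key, ⟨?_, ?_⟩, ?_⟩
  · intro a ha b hb hab
    obtain ⟨u, hu, rfl⟩ := Finset.mem_image.1 ha
    obtain ⟨v, hv, rfl⟩ := Finset.mem_image.1 hb
    rw [key u hu, key v hv] at hab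
    rw [hab]
  · intro a ha b hb
    obtain ⟨u, hu, rfl⟩ := Finset.mem_image.1 ha
    obtain ⟨v, hv, rfl⟩ := Finset.mem_image.1 hb
    rw [key u hu, key v hv]
    exact (h.2 u hu v hv).symm
  · rw [Finset.image_image]
    conv_rhs => rw [← Finset.image_id (s := A)]
    apply Finset.image_congr
    intro a ha
    exact key a ha

lemma Inv.symm [Nonempty V] {G : SimpleGraph V} {G' : SimpleGraph V'} {D i r : ℕ} {x : Fin r → V}
    {y : Fin r → V'} (h : Inv G G' D i x y) : Inv G' G D i y x := by
  obtain ⟨c, A, φ, h1, h2⟩ := h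
  have : ∀ t, ∃ ψ : V' → V, (IsoOn G G' (φ t) (A t)) → (∀ a ∈ A t, ψ (φ t a) = a) ∧
      IsoOn G' G ψ ((A t).image (φ t)) ∧ ((A t).image (φ t)).image ψ = A t := by
    intro t
    by_cases ht : IsoOn G G' (φ t) (A t)
    · obtain ⟨ψ, hψ⟩ := ht.symm
      exact ⟨ψ, fun _ => hψ⟩
    · exact ⟨fun _ => Classical.arbitrary V, fun h => absurd h ht⟩
  choose ψ hψ using this
  refine ⟨c, fun t => (A t).image (φ t), ψ, ?_, fun j l hc => ⟨(h2 j l hc).2, (h2 j l hc).1⟩⟩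
  intro j
  obtain ⟨a1, a2, a3, a4, a5, a6⟩ := h1 j
  obtain ⟨b1, b2, b3⟩ := hψ _ a3
  refine ⟨?_, ?_, b2, a5, ?_, ?_⟩
  · rw [a2]; exact Finset.mem_image_of_mem _ a1
  · rw [a2, b1 _ a1]
  · rw [b3]; exact a4
  · exact (Nat.add_le_add_right Finset.card_image_le _).trans a6

/-- closure size bound -/
def cb (s q : ℕ) : ℕ := q + s * (2 * q + 1)

lemma cb_mono (s : ℕ) {q q' : ℕ} (h : q ≤ q') : cb s q ≤ cb s q' := by
  unfold cb
  have := Nat.mul_le_mul_left s (by omega : 2 * q + 1 ≤ 2 * q' + 1)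
  omega

lemma Inv.forth [Nonempty V'] {G : SimpleGraph V} {G' : SimpleGraph V'} {α : ℝ} {D m i r : ℕ}
    (hα : ((2 ^ m - 1 : ℕ) + 1) * (1 - α) ≤ (1:ℝ) / 2) (hα1 : α < 1) (hne : NonExc α D)
    (hN : NN α D G) (hG' : Good α D G') (him : i + 1 ≤ m)
    (hD1 : cb (2 ^ m - 1) 1 + 2 ^ m ≤ D)
    (hD2 : cb (2 ^ m - 1) 1 + cb (2 ^ m - 1) r ≤ D)
    {x : Fin r → V} {y : Fin r → V'}
    (h : Inv G G' D (i + 1) x y) (z : V) :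
    ∃ z', Inv G G' D i (r := r + 1) (Fin.snoc x z) (Fin.snoc y z') := by
  obtain ⟨c, A, φ, h1, h2⟩ := h
  have hpow : 2 ^ (i + 1) = 2 ^ i + 2 ^ i := by ring
  have hpos : 1 ≤ 2 ^ i := Nat.one_le_two_pow
  have hm : 2 ^ (i + 1) ≤ 2 ^ m := Nat.pow_le_pow_right (by norm_num) him
  have hα0 : 0 < α := by
    have : (0:ℝ) ≤ (2 ^ m - 1 : ℕ) := by positivity
    nlinarith
  by_cases hnear : ∃ j, Reach G (2 ^ i) (x j) z
  · obtain ⟨j, hj⟩ := hnear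
    obtain ⟨a1, a2, a3, a4, a5, a6⟩ := h1 j
    obtain ⟨B, b1, b2, b3, b4, b5⟩ := near G' a1 hj
    have hsafe : Safe α G (A (c j)) B := safe_near hα0 hα1 a4 (by omega)
    obtain ⟨ψ, p1, p2, p3⟩ := hG'.extend_iso G b1 (by omega) hsafe (φ (c j)) a3
    have hBcl : Closed G (2 ^ i - 1) B := by
      intro T hT1 hT2
      have := a4 T (b1.trans hT1) (by omega)
      omega
    have hsub : (A (c j)).image (φ (c j)) ⊆ B.image ψ := by
      intro a ha
      obtain ⟨u, hu, rfl⟩ := Finset.mem_image.1 ha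
      rw [← p2 u hu]
      exact Finset.mem_image_of_mem _ (b1 hu)
    have hα' : (((2 ^ i - 1 : ℕ) : ℝ) + 1) * (1 - α) ≤ (1:ℝ) / 2 := by
      refine le_trans ?_ hα
      have : ((2 ^ i - 1 : ℕ) : ℝ) ≤ (2 ^ m - 1 : ℕ) := by exact_mod_cast (by omega)
      apply mul_le_mul_of_nonneg_right <;> linarith
    have hBcl' : Closed G' (2 ^ i - 1) (B.image ψ) :=
      p3.closed hα' hα1 (by omega) hsub (a5.mono (by omega))
    have hreach : Reach G' (2 ^ i) (y j) (ψ z) := by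
      rw [a2, ← p2 _ a1]
      exact b5 ψ p1
    have pairG : ∀ l, c l ≠ c j → ¬ Reach G (2 ^ i) (x l) z := by
      intro l hl hr
      apply (h2 l j hl).1
      rw [hpow]
      exact hr.trans hj.symm
    have pairG' : ∀ l, c l ≠ c j → ¬ Reach G' (2 ^ i) (y l) (ψ z) := by
      intro l hl hr
      apply (h2 l j hl).2
      rw [hpow]
      exact hr.trans hreach.symm
    refine ⟨ψ z, Fin.snoc c (c j), Function.update A (c j) B, Function.update φ (c j) ψ, ?_, ?_⟩
    · intro l
      refine Fin.lastCases ?_ (fun l => ?_) l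
      · simp only [Fin.snoc_last, Function.update_self]
        exact ⟨b4, by trivial, p1, hBcl, hBcl', by omega⟩
      · simp only [Fin.snoc_castSucc]
        obtain ⟨d1, d2, d3, d4, d5, d6⟩ := h1 l
        by_cases hl : c l = c j
        · simp only [hl, Function.update_self]
          rw [hl] at d1 d2
          exact ⟨b1 d1, by rw [d2, p2 _ d1], p1, hBcl, hBcl', by omega⟩
        · simp only [Function.update_of_ne hl]
          exact ⟨d1, d2, d3, d4.mono (by omega), d5.mono (by omega), by omega⟩
    · intro l l'
      refine Fin.lastCases ?_ (fun l => ?_) l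
      · refine Fin.lastCases ?_ (fun l' => ?_) l'
        · simp
        · simp only [Fin.snoc_last, Fin.snoc_castSucc]
          intro hc
          exact ⟨fun hr => pairG l' (Ne.symm hc) hr.symm, fun hr => pairG' l' (Ne.symm hc) hr.symm⟩
      · refine Fin.lastCases ?_ (fun l' => ?_) l'
        · simp only [Fin.snoc_last, Fin.snoc_castSucc]
          intro hc
          exact ⟨pairG l hc, pairG' l hc⟩
        · simp only [Fin.snoc_castSucc]
          intro hc
          exact ⟨fun hr => (h2 l l' hc).1 (hr.mono (by omega)),
            fun hr => (h2 l l' hc).2 (hr.mono (by omega))⟩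
  · push Not at hnear
    obtain ⟨R, hR1, hR2, hR3⟩ := exists_closed hα hα1 hG'.nn (Finset.univ.image y) r
      (Finset.card_image_le.trans (by simp)) (by unfold cb at hD2; omega)
    obtain ⟨Az, hz1, hz2, hz3⟩ := exists_closed hα hα1 hN {z} 1 (by simp) (by unfold cb at hD2; omega)
    obtain ⟨ψ, p1, p2, p3⟩ := Good.far_copy hα hα1 (by omega) hne hN hG' (A := Az) (R := R)
      (by unfold cb at hD2; omega) hR2
    obtain ⟨t, ht⟩ := Infinite.exists_notMem_finset (Finset.univ.image c)
    have ht : ∀ l, c l ≠ t := by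
      intro l hl; apply ht; rw [← hl]; simp
    have hzA : z ∈ Az := hz1 (by simp)
    have pairG' : ∀ l, ¬ Reach G' (2 ^ i) (y l) (ψ z) := by
      intro l
      exact p3 _ (by omega) (y l) (hR1 (by simp)) z hzA
    refine ⟨ψ z, Fin.snoc c t, Function.update A t Az, Function.update φ t ψ, ?_, ?_⟩
    · intro l
      refine Fin.lastCases ?_ (fun l => ?_) l
      · simp only [Fin.snoc_last, Function.update_self]
        refine ⟨hzA, by trivial, p1, hz2.mono (by omega), p2.mono (by omega), ?_⟩
        unfold cb at hD1; omega
      · simp only [Fin.snoc_castSucc, Function.update_of_ne (ht l)]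
        obtain ⟨d1, d2, d3, d4, d5, d6⟩ := h1 l
        exact ⟨d1, d2, d3, d4.mono (by omega), d5.mono (by omega), by omega⟩
    · intro l l'
      refine Fin.lastCases ?_ (fun l => ?_) l
      · refine Fin.lastCases ?_ (fun l' => ?_) l'
        · simp
        · simp only [Fin.snoc_last, Fin.snoc_castSucc]
          intro hc
          exact ⟨fun hr => hnear l' hr.symm, fun hr => pairG' l' hr.symm⟩
      · refine Fin.lastCases ?_ (fun l' => ?_) l'
        · simp only [Fin.snoc_last, Fin.snoc_castSucc]
          intro hc
          exact ⟨hnear l, pairG' l⟩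
        · simp only [Fin.snoc_castSucc]
          intro hc
          exact ⟨fun hr => (h2 l l' hc).1 (hr.mono (by omega)),
            fun hr => (h2 l l' hc).2 (hr.mono (by omega))⟩

lemma Inv.eqI [Nonempty V] [Nonempty V'] {G : SimpleGraph V} {G' : SimpleGraph V'} {α : ℝ}
    {D m : ℕ} (k : ℕ)
    (hα : ((2 ^ m - 1 : ℕ) + 1) * (1 - α) ≤ (1:ℝ) / 2) (hα1 : α < 1) (hne : NonExc α D)
    (hG : Good α D G) (hG' : Good α D G')
    (hD1 : cb (2 ^ m - 1) 1 + 2 ^ m ≤ D)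
    (hD2 : cb (2 ^ m - 1) 1 + cb (2 ^ m - 1) k ≤ D) (i : ℕ) :
    ∀ {r : ℕ}, i ≤ m → r + i ≤ k → ∀ {x : Fin r → V} {y : Fin r → V'},
    Inv G G' D i x y → EqI G G' i x y := by
  induction i with
  | zero => intro r _ _ x y h; exact h.atomic
  | succ i ih =>
    intro r him hrk x y h
    have hD2' : cb (2 ^ m - 1) 1 + cb (2 ^ m - 1) r ≤ D := by
      have := cb_mono (2 ^ m - 1) (by omega : r ≤ k)
      omega
    refine ⟨h.atomic, fun z => ?_, fun z' => ?_⟩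
    · obtain ⟨z', hz'⟩ := h.forth hα hα1 hne hG.nn hG' him hD1 hD2' z
      exact ⟨z', ih (by omega) (by omega) hz'⟩
    · obtain ⟨z, hz⟩ := h.symm.forth hα hα1 hne hG'.nn hG him hD1 hD2' z'
      exact ⟨z, ih (by omega) (by omega) hz.symm⟩

end Game
end RandomGraphSpectra

namespace RandomGraphSpectra

section First
variable {V V' : Type*} [DecidableEq V] [DecidableEq V']

abbrev MType (b : ℕ) : Type := Σ t : Fin (b + 1), SimpleGraph (Fin t) × Fin t × Fin t

/-- two pairs of vertices lie in isomorphic closed sets -/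
def Pair (G : SimpleGraph V) (G' : SimpleGraph V') (D m : ℕ) (x y : V) (x' y' : V') : Prop :=
  ∃ (A : Finset V) (φ : V → V'), x ∈ A ∧ y ∈ A ∧ φ x = x' ∧ φ y = y' ∧ IsoOn G G' φ A ∧
    Closed G (2 ^ m - 1) A ∧ Closed G' (2 ^ m - 1) (A.image φ) ∧ A.card + 2 ^ m ≤ D

lemma Pair.symm [Nonempty V] {G : SimpleGraph V} {G' : SimpleGraph V'} {D m : ℕ} {x y : V}
    {x' y' : V'} (h : Pair G G' D m x y x' y') : Pair G' G D m x' y' x y := by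
  obtain ⟨A, φ, h1, h2, rfl, rfl, h5, h6, h7, h8⟩ := h
  obtain ⟨ψ, p1, p2, p3⟩ := h5.symm
  refine ⟨A.image φ, ψ, Finset.mem_image_of_mem _ h1, Finset.mem_image_of_mem _ h2, p1 _ h1,
    p1 _ h2, p2, h7, by rw [p3]; exact h6, ?_⟩
  exact (Nat.add_le_add_right Finset.card_image_le _).trans h8

lemma Pair.inv {G : SimpleGraph V} {G' : SimpleGraph V'} {D m : ℕ} {x y : V}
    {x' y' : V'} (h : Pair G G' D m x y x' y') (a : Fin 0 → V) (b : Fin 0 → V') :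
    Inv G G' D m (r := 2) (Fin.snoc (n := 1) (Fin.snoc (n := 0) a x : Fin 1 → V) y : Fin 2 → V)
      (Fin.snoc (n := 1) (Fin.snoc (n := 0) b x' : Fin 1 → V') y' : Fin 2 → V') := by
  obtain ⟨A, φ, h1, h2, rfl, rfl, h5, h6, h7, h8⟩ := h
  refine ⟨fun _ => 0, fun _ => A, fun _ => φ, ?_, fun j l h => absurd rfl h⟩
  intro j
  refine ⟨?_, ?_, h5, h6, h7, h8⟩
  · refine Fin.lastCases ?_ (fun j => ?_) j
    · rw [Fin.snoc_last]; exact h2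
    · rw [Fin.snoc_castSucc]
      refine Fin.lastCases ?_ (fun j => j.elim0) j
      rw [Fin.snoc_last]; exact h1
  · refine Fin.lastCases ?_ (fun j => ?_) j
    · rw [Fin.snoc_last, Fin.snoc_last]
    · rw [Fin.snoc_castSucc, Fin.snoc_castSucc]
      refine Fin.lastCases ?_ (fun j => j.elim0) j
      rw [Fin.snoc_last, Fin.snoc_last]

/-- size of the union of all type witnesses -/
noncomputable def w0 (b : ℕ) : ℕ := 1 + Nat.card (MType b) * b

lemma first_move [Nonempty V] [Nonempty V'] {G : SimpleGraph V} {G' : SimpleGraph V'} {α : ℝ}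
    {D m : ℕ}
    (hα : ((2 ^ m - 1 : ℕ) + 1) * (1 - α) ≤ (1:ℝ) / 2) (hα1 : α < 1) (hne : NonExc α D)
    (hG : Good α D G) (hG' : Good α D G')
    (hD1 : cb (2 ^ m - 1) 2 + 2 ^ m ≤ D)
    (hD2 : cb (2 ^ m - 1) (cb (2 ^ m - 1) (w0 (cb (2 ^ m - 1) 2)) + 1) + 2 ^ m ≤ D) (x : V) :
    ∃ x' : V', (∀ y, ∃ y', Pair G G' D m x y x' y') ∧ (∀ y', ∃ y, Pair G G' D m x y x' y') := by
  classical
  set s := 2 ^ m - 1 with hs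
  set b := cb s 2 with hb
  have hpos : 1 ≤ 2 ^ m := Nat.one_le_two_pow
  have hq : ∀ q, q ≤ cb s q := fun q => by unfold cb; omega
  have hw0 : cb s (w0 b) ≤ D := by
    have := hq (cb s (w0 b) + 1)
    omega
  have hsD : s ≤ D := by omega
  -- witnesses
  let HasW : (τ : MType b) → (Fin τ.1 → V) → Prop := fun τ ψ =>
    IsoOn τ.2.1 G ψ Finset.univ ∧ ψ τ.2.2.1 = x ∧ Closed G s (Finset.univ.image ψ)
  have hch : ∀ τ : MType b, ∃ ψ : Fin τ.1 → V, (∃ ψ', HasW τ ψ') → HasW τ ψ := by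
    intro τ
    by_cases h : ∃ ψ', HasW τ ψ'
    · obtain ⟨ψ, hψ⟩ := h; exact ⟨ψ, fun _ => hψ⟩
    · exact ⟨fun _ => x, fun h' => absurd h' h⟩
  choose ψ hψ using hch
  let X : Finset V := {x} ∪ Finset.univ.biUnion (fun τ : MType b => Finset.univ.image (ψ τ))
  have hX : X.card ≤ w0 b := by
    refine (Finset.card_union_le _ _).trans ?_
    unfold w0
    refine Nat.add_le_add (by simp) ?_
    refine Finset.card_biUnion_le.trans ?_
    rw [Nat.card_eq_fintype_card, ← Finset.card_univ]
    refine Finset.sum_le_card_nsmul _ _ _ ?_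
    intro τ _
    refine Finset.card_image_le.trans ?_
    rw [Finset.card_univ, Fintype.card_fin]
    exact Nat.lt_succ_iff.1 τ.1.2
  obtain ⟨W, hXW, hWcl, hWc⟩ := exists_closed hα hα1 hG.nn X (w0 b) hX hw0
  obtain ⟨χ, c1, c2, c3⟩ := hG'.extend_iso G (A := ∅) (B := W) (Finset.empty_subset _)
    (hWc.trans hw0) (safe_empty hne hG.nn (hWc.trans hw0)) (fun _ => Classical.arbitrary V')
    ⟨by simp, by simp⟩
  simp only [Finset.image_empty] at c3
  have hW'cl : Closed G' s (W.image χ) :=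
    c3.closed hα hα1 hsD (Finset.empty_subset _) (closed_empty hα hα1 hG'.nn hsD)
  have hxW : x ∈ W := hXW (by simp [X])
  refine ⟨χ x, fun y => ?_, fun y' => ?_⟩
  · obtain ⟨A, a1, a2, a3⟩ := exists_closed hα hα1 hG.nn {x, y} 2 Finset.card_le_two (by
      change b ≤ D; omega)
    have hxA : x ∈ A := a1 (by simp)
    have hyA : y ∈ A := a1 (by simp)
    set e := A.equivFin with he
    let i : Fin A.card → V := fun j => (e.symm j : V)
    have hi : Function.Injective i := fun a b h => e.symm.injective (Subtype.ext h)
    have hie : ∀ u (hu : u ∈ A), i (e ⟨u, hu⟩) = u := by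
      intro u hu; simp [i]
    have him : Finset.univ.image i = A := by
      ext a
      simp only [Finset.mem_image, Finset.mem_univ, true_and]
      constructor
      · rintro ⟨j, rfl⟩; exact (e.symm j).2
      · intro ha; exact ⟨_, hie a ha⟩
    let τ : MType b := ⟨⟨A.card, Nat.lt_succ_of_le a3⟩, G.comap i, e ⟨x, hxA⟩, e ⟨y, hyA⟩⟩
    have hτ : HasW τ (ψ τ) := by
      apply hψ
      refine ⟨i, ⟨hi.injOn, fun u _ v _ => Iff.rfl⟩, hie _ _, ?_⟩
      change Closed G s (Finset.univ.image i)
      rw [him]; exact a2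
    obtain ⟨t1, t2, t3⟩ := hτ
    let j : V → Fin A.card := fun u => if hu : u ∈ A then e ⟨u, hu⟩ else e ⟨x, hxA⟩
    have hj : ∀ u (hu : u ∈ A), j u = e ⟨u, hu⟩ := fun u hu => dif_pos hu
    let θ : V → V := fun u => ψ τ (j u)
    have hθ : IsoOn G G θ A := by
      constructor
      · intro u hu v hv huv
        have := t1.1 (by simp) (by simp) huv
        rw [hj u hu, hj v hv] at this
        simpa using this
      · intro u hu v hv
        have := t1.2 (j u) (by simp) (j v) (by simp)
        rw [← this]
        simp only [τ, SimpleGraph.comap_adj]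
        rw [hj u hu, hj v hv, hie, hie]
    have hθim : A.image θ = Finset.univ.image (ψ τ) := by
      ext a
      simp only [Finset.mem_image, Finset.mem_univ, true_and]
      constructor
      · rintro ⟨u, _, rfl⟩; exact ⟨_, rfl⟩
      · rintro ⟨l, rfl⟩
        refine ⟨i l, (e.symm l).2, ?_⟩
        simp only [θ]
        rw [hj (i l) (e.symm l).2]
        simp [i]
    have hsub : Finset.univ.image (ψ τ) ⊆ W := by
      refine Finset.Subset.trans ?_ hXW
      intro a ha
      simp only [X, Finset.mem_union, Finset.mem_biUnion]
      exact Or.inr ⟨τ, Finset.mem_univ _, ha⟩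
    have hθW : ∀ u ∈ A, θ u ∈ W := by
      intro u hu
      apply hsub
      rw [← hθim]
      exact Finset.mem_image_of_mem _ hu
    refine ⟨χ (θ y), A, χ ∘ θ, hxA, hyA, ?_, rfl, ⟨?_, ?_⟩, a2, ?_, ?_⟩
    · simp only [Function.comp_apply, θ]
      rw [hj x hxA]
      congr 1
    · intro u hu v hv huv
      exact hθ.1 hu hv (c1.1 (hθW u hu) (hθW v hv) huv)
    · intro u hu v hv
      rw [hθ.2 u hu v hv, c1.2 _ (hθW u hu) _ (hθW v hv)]; rfl
    · rw [← Finset.image_image, hθim]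
      exact Closed.trans (Finset.image_subset_image hsub) (Closed.image_in c1 hsub t3) hW'cl
    · have : A.card ≤ b := a3
      omega
  · have hW'c : (W.image χ).card ≤ cb s (w0 b) := Finset.card_image_le.trans hWc
    obtain ⟨C, d1, d2, d3⟩ := exists_closed hα hα1 hG'.nn (insert y' (W.image χ)) (cb s (w0 b) + 1)
      ((Finset.card_insert_le _ _).trans (by omega)) (by
        have : cb s (cb s (w0 b) + 1) ≤ D := by omega
        exact this)
    have d3 : C.card ≤ cb s (cb s (w0 b) + 1) := d3
    have hCD : C.card + 2 ^ m ≤ D := by omega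
    have hWC : W.image χ ⊆ C := (Finset.subset_insert _ _).trans d1
    obtain ⟨χ', q1, q2, q3⟩ := c1.symm
    have hsafe : Safe α G' (W.image χ) C := by
      apply safe_of_le hne (by omega)
      intro S h1 h2
      apply c3.strong hG'.nn h1
      have := Finset.card_le_card h2
      omega
    obtain ⟨g, g1, g2, g3⟩ := hG.extend_iso G' hWC (by omega) hsafe χ' q2
    rw [q3] at g3
    have hcl := g3.closed hα hα1 hsD (by
      rw [← q3]
      intro a ha
      obtain ⟨u, hu, rfl⟩ := Finset.mem_image.1 ha
      rw [← g2 u hu]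
      exact Finset.mem_image_of_mem _ (hWC hu)) hWcl
    refine ⟨g y', Pair.symm ⟨C, g, hWC (Finset.mem_image_of_mem _ hxW), d1 (by simp), ?_, rfl,
      g1, d2, hcl, hCD⟩⟩
    rw [g2 _ (Finset.mem_image_of_mem _ hxW), q1 x hxW]

theorem good_eqI [Nonempty V] [Nonempty V'] {G : SimpleGraph V} {G' : SimpleGraph V'} {α : ℝ}
    {D m : ℕ}
    (hα : ((2 ^ m - 1 : ℕ) + 1) * (1 - α) ≤ (1:ℝ) / 2) (hα1 : α < 1) (hne : NonExc α D)
    (hG : Good α D G) (hG' : Good α D G')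
    (hD1 : cb (2 ^ m - 1) 2 + 2 ^ m ≤ D)
    (hD2 : cb (2 ^ m - 1) (cb (2 ^ m - 1) (w0 (cb (2 ^ m - 1) 2)) + 1) + 2 ^ m ≤ D)
    (hD3 : cb (2 ^ m - 1) 1 + cb (2 ^ m - 1) (m + 2) ≤ D) (a : Fin 0 → V) (b : Fin 0 → V') :
    EqI G G' (m + 2) a b := by
  have hD0 : cb (2 ^ m - 1) 1 + 2 ^ m ≤ D := by
    have := cb_mono (2 ^ m - 1) (by norm_num : 1 ≤ 2)
    omega
  have fin : ∀ {x y x' y'}, Pair G G' D m x y x' y' →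
      EqI G G' m (r := 2) (Fin.snoc (n := 1) (Fin.snoc (n := 0) a x : Fin 1 → V) y : Fin 2 → V)
      (Fin.snoc (n := 1) (Fin.snoc (n := 0) b x' : Fin 1 → V') y' : Fin 2 → V') := by
    intro x y x' y' h
    exact Inv.eqI (m + 2) hα hα1 hne hG hG' hD0 hD3 m le_rfl (by omega) (h.inv a b)
  have at1 : ∀ (x : V) (x' : V'), Atomic G G' (r := 1) (Fin.snoc (n := 0) a x : Fin 1 → V)
      (Fin.snoc (n := 0) b x' : Fin 1 → V') := by
    intro x x' j l
    have : j = l := Subsingleton.elim _ _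
    subst this
    simp
  refine ⟨fun j => j.elim0, fun x => ?_, fun x' => ?_⟩
  · obtain ⟨x', h1, h2⟩ := first_move hα hα1 hne hG hG' hD1 hD2 x
    refine ⟨x', at1 x x', fun y => ?_, fun y' => ?_⟩
    · obtain ⟨y', h⟩ := h1 y; exact ⟨y', fin h⟩
    · obtain ⟨y, h⟩ := h2 y'; exact ⟨y, fin h⟩
  · obtain ⟨x, h1, h2⟩ := first_move hα hα1 hne hG' hG hD1 hD2 x'
    refine ⟨x, at1 x x', fun y => ?_, fun y' => ?_⟩
    · obtain ⟨y', h⟩ := h2 y; exact ⟨y', fin h.symm⟩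
    · obtain ⟨y, h⟩ := h1 y'; exact ⟨y, fin h.symm⟩

end First
end RandomGraphSpectra

namespace RandomGraphSpectra

section Step
variable {V : Type*} [DecidableEq V]

lemma extG_refl (α : ℝ) (D : ℕ) (G : SimpleGraph V) {t : ℕ} (F : SimpleGraph (Fin t))
    (W : Finset (Fin t)) : ExtG α D G F W W := by
  intro g hg
  refine ⟨g, hg, fun _ _ => rfl, fun u hu v hv h => absurd ⟨hu, hv⟩ h, ?_⟩
  intro T _ _ _ u _ _ v hv hv'
  exact absurd hv hv'

lemma extG_trans {α : ℝ} {D : ℕ} {G : SimpleGraph V} {t : ℕ} {F : SimpleGraph (Fin t)}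
    {W W1 U : Finset (Fin t)} (h1 : W ⊆ W1) (h2 : W1 ⊆ U) (e1 : ExtG α D G F W W1)
    (e2 : ExtG α D G F W1 U) : ExtG α D G F W U := by
  intro g hg
  obtain ⟨g1, a1, a2, a3, a4⟩ := e1 g hg
  obtain ⟨g2, b1, b2, b3, b4⟩ := e2 g1 a1
  refine ⟨g2, b1, fun u hu => by rw [b2 u (h1 hu), a2 u hu], ?_, ?_⟩
  · intro u hu v hv huv
    by_cases h : u ∈ W1 ∧ v ∈ W1
    · rw [b2 u h.1, b2 v h.2]
      exact a3 u h.1 v h.2 huv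
    · exact b3 u hu v hv h
  · set C1 := W1.image g1 with hC1
    set C2 := U.image g2 with hC2
    have hC12 : C1 ⊆ C2 := by
      intro a ha
      obtain ⟨u, hu, rfl⟩ := Finset.mem_image.1 ha
      rw [← b2 u hu]
      exact Finset.mem_image_of_mem _ (h2 hu)
    intro T hT1 hT2 hT3
    have hno := b4 T hT1 hT2 hT3
    intro u hu huC v hv hvW
    by_cases hvC1 : v ∈ C1
    swap
    · exact hno u hu huC v hv hvC1
    -- transfer balance
    have key : ∀ Z, C1 ⊆ Z → Z ⊆ C1 ∪ (T \ C2) →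
        fR α G (Z ∪ C2) + fR α G C1 = fR α G Z + fR α G C2 := by
      intro Z hZ1 hZ2
      have hmem : ∀ a ∈ Z, a ∉ C2 → a ∈ T := by
        intro a ha ha2
        have := hZ2 ha
        simp only [Finset.mem_union, Finset.mem_sdiff] at this
        rcases this with h | h
        · exact absurd (hC12 h) ha2
        · exact h.1
      have hE := eN_noedge G Z C2 (by
        intro a ha ha2 b hb hb2
        exact hno a (hmem a ha ha2) ha2 b hb (fun h => hb2 (hZ1 h)))
      have hI : Z ∩ C2 = C1 := by
        ext a
        simp only [Finset.mem_inter]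
        constructor
        · rintro ⟨h, h'⟩
          have := hZ2 h
          simp only [Finset.mem_union, Finset.mem_sdiff] at this
          tauto
        · intro h; exact ⟨hZ1 h, hC12 h⟩
      have hc := Finset.card_union_add_card_inter Z C2
      rw [hI] at hE hc
      have hE' : (eN G (Z ∪ C2) : ℝ) + eN G C1 = eN G Z + eN G C2 := by exact_mod_cast hE
      have hc' : ((Z ∪ C2).card : ℝ) + C1.card = Z.card + C2.card := by exact_mod_cast hc
      unfold fR
      linear_combination hc' - α * hE'
    have hTT : C1 ∪ (T \ C2) ∪ C2 = T := by
      ext a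
      have := @hC12 a
      have := @hT1 a
      simp only [Finset.mem_union, Finset.mem_sdiff]
      tauto
    refine a4 (C1 ∪ (T \ C2)) Finset.subset_union_left ?_ ?_ u ?_ (fun h => huC (hC12 h)) v hvC1 hvW
    · refine (Finset.card_union_le _ _).trans ?_
      rw [Finset.card_sdiff_of_subset hT1]
      omega
    · intro T1 hT11 hT12 hT13
      have k1 := key T1 hT11 hT12
      have k2 := key _ Finset.subset_union_left subset_rfl
      rw [hTT] at k2
      have k3 := hT3 (T1 ∪ C2) Finset.subset_union_right (by
        rw [← hTT]; exact Finset.union_subset_union_left hT12) (by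
        intro h
        apply hT13
        apply Finset.Subset.antisymm hT12
        intro a ha
        rw [Finset.mem_union] at ha
        rcases ha with ha | ha
        · exact hT11 ha
        · rw [Finset.mem_sdiff] at ha
          have := ha.1
          rw [← h, Finset.mem_union] at this
          exact this.resolve_right ha.2)
      linarith
    · simp [hu, huC]

/-- Abundance of copies inside `B`. -/
def AA (G : SimpleGraph V) {t : ℕ} (F : SimpleGraph (Fin t)) (W V0 : Finset (Fin t))
    (B : Finset V) (Dy : ℕ) : Prop :=
  ∀ g : Fin t → V, Set.InjOn g W → ∀ Y : Finset V, Y.card ≤ Dy → W.image g ⊆ Y →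
    ∃ g' : Fin t → V, Set.InjOn g' (W ∪ V0 : Finset (Fin t)) ∧ (∀ u ∈ W, g' u = g u) ∧
      (∀ u ∈ V0, g' u ∈ B ∧ g' u ∉ Y) ∧
      (∀ u ∈ W ∪ V0, ∀ v ∈ W ∪ V0, ¬ (u ∈ W ∧ v ∈ W) → F.Adj u v → G.Adj (g' u) (g' v))

noncomputable def Phi (α w : ℝ) (G : SimpleGraph V) (P Q : Finset V) : ℝ :=
  w * P.card + Q.card - α * eN G (P ∪ Q)

/-- weighted sparsity -/
def N2 (α w : ℝ) (G : SimpleGraph V) (B : Finset V) (M : ℕ) : Prop :=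
  ∀ P ⊆ B, ∀ Q, Disjoint P Q → P.card + Q.card ≤ M → 0 ≤ Phi α w G P Q

set_option maxHeartbeats 1600000 in
lemma ext_step {α δ w η : ℝ} {D t L : ℕ} (hα : 0 < α)
    (hδ : ∀ a ≤ D, ∀ b : ℕ, (a : ℝ) - α * b < 0 → (a : ℝ) - α * b ≤ -δ)
    (hη0 : 0 ≤ η) (hη : t * η ≤ δ / 2) (hL : (t : ℝ) < L * (δ / 2))
    {F : SimpleGraph (Fin t)} {W V0 : Finset (Fin t)} (hdis : Disjoint W V0)
    (hw : w * V0.card = α * (eN F (W ∪ V0) - eN F W))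
    {G : SimpleGraph V} {B : Finset V} (hA : AA G F W V0 B (t + L * (t + D)))
    (hN : N2 α (w + η) G B (t + L * (t + D))) : ExtG α D G F W (W ∪ V0) := by
  intro g hg
  by_contra hcon
  have hδα : δ ≤ α := by
    have := hδ 0 (by omega) 1 (by simpa using hα)
    simp at this; linarith
  have hcard : ∀ S : Finset (Fin t), S.card ≤ t := fun S => by
    simpa using Finset.card_le_univ S
  have key : ∀ j ≤ L, ∃ P Q, P ⊆ B ∧ Disjoint P Q ∧ P.card + Q.card ≤ t + j * (t + D) ∧
      W.image g ⊆ P ∪ Q ∧ Phi α (w + η) G P Q ≤ t - j * (δ / 2) := by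
    intro j
    induction j with
    | zero =>
      intro _
      refine ⟨∅, W.image g, by simp, by simp, ?_, by simp, ?_⟩
      · have := (Finset.card_image_le (s := W) (f := g)).trans (hcard W)
        simpa using this
      · have := (Finset.card_image_le (s := W) (f := g)).trans (hcard W)
        have h2 : ((W.image g).card : ℝ) ≤ t := by exact_mod_cast this
        have h3 : 0 ≤ α * eN G (W.image g) := by positivity
        simp only [Phi, Finset.card_empty, Finset.empty_union]
        push_cast
        linarith
    | succ j ih =>
      intro hj
      obtain ⟨P, Q, hP, hPQ, hc, hWPQ, hPhi⟩ := ih (by omega)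
      set X := P ∪ Q with hX
      have hXc : X.card = P.card + Q.card := Finset.card_union_of_disjoint hPQ
      have hjL : j * (t + D) + (t + D) ≤ L * (t + D) := by
        rw [← Nat.succ_mul]; exact Nat.mul_le_mul_right _ hj
      obtain ⟨g', c1, c2, c3, c4⟩ := hA g hg X (by omega) hWPQ
      set H := V0.image g' with hH
      set C := (W ∪ V0).image g' with hC
      have hWim : W.image g' = W.image g := Finset.image_congr (fun u hu => c2 u hu)
      have hCeq : C = W.image g ∪ H := by rw [hC, Finset.image_union, hWim]
      have hHX : Disjoint H X := by
        rw [Finset.disjoint_left]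
        intro a ha
        obtain ⟨u, hu, rfl⟩ := Finset.mem_image.1 ha
        exact (c3 u hu).2
      have hHB : H ⊆ B := by
        intro a ha
        obtain ⟨u, hu, rfl⟩ := Finset.mem_image.1 ha
        exact (c3 u hu).1
      have hHc : H.card = V0.card := Finset.card_image_of_injOn (c1.mono (by
        intro a ha; exact Finset.mem_union_right _ ha))
      have hXC : X ∩ C = W.image g := by
        ext a
        have h1 := @hWPQ a
        have h2 : a ∈ H → a ∉ X := fun h => Finset.disjoint_left.1 hHX h
        rw [hCeq]
        simp only [Finset.mem_inter, Finset.mem_union] at *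
        tauto
      have hXCH : X ∪ C = (P ∪ H) ∪ Q := by
        ext a
        have h1 := @hWPQ a
        rw [hCeq]
        simp only [hX, Finset.mem_union] at *
        tauto
      have hrel := eN_rel_le F G g' W (W ∪ V0) Finset.subset_union_left c1 c4
      rw [hWim, ← hC] at hrel
      have hsup := eN_super G X C
      rw [hXC] at hsup
      have hPH : (P ∪ H).card = P.card + V0.card := by
        rw [Finset.card_union_of_disjoint, hHc]
        rw [Finset.disjoint_left]
        intro a ha ha'
        exact Finset.disjoint_left.1 hHX ha' (Finset.mem_union_left _ ha)
      have hPHQ : Disjoint (P ∪ H) Q := by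
        rw [Finset.disjoint_union_left]
        refine ⟨hPQ, ?_⟩
        rw [Finset.disjoint_left]
        intro a ha ha'
        exact Finset.disjoint_left.1 hHX ha (Finset.mem_union_right _ ha')
      have hv : (V0.card : ℝ) ≤ t := by exact_mod_cast hcard V0
      have hvη : η * V0.card ≤ δ / 2 := by nlinarith
      -- extra edge in `X ∪ C`
      have extra : eN F (W ∪ V0) + eN G X + 1 ≤ eN G (X ∪ C) + eN F W →
          ∃ P Q, P ⊆ B ∧ Disjoint P Q ∧ P.card + Q.card ≤ t + (j + 1) * (t + D) ∧
            W.image g ⊆ P ∪ Q ∧ Phi α (w + η) G P Q ≤ t - (j + 1 : ℕ) * (δ / 2) := by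
        intro hex
        refine ⟨P ∪ H, Q, Finset.union_subset hP hHB, hPHQ, ?_, ?_, ?_⟩
        · have := hcard V0
          rw [hPH, Nat.succ_mul]; omega
        · rw [← hXCH]; exact hWPQ.trans Finset.subset_union_left
        · have hex' : (eN F (W ∪ V0) + eN G X + 1 : ℝ) ≤ eN G (X ∪ C) + eN F W := by
            exact_mod_cast hex
          have := mul_le_mul_of_nonneg_left hex' hα.le
          unfold Phi at hPhi ⊢
          rw [← hXCH, hPH]
          push_cast
          have e1 : (w+η)*((P.card:ℝ)+V0.card) = (w+η)*P.card + w*V0.card + η*V0.card := by ring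
          linarith
      by_cases hexact : ∀ u ∈ W ∪ V0, ∀ v ∈ W ∪ V0, ¬ (u ∈ W ∧ v ∈ W) →
          (F.Adj u v ↔ G.Adj (g' u) (g' v))
      swap
      · push Not at hexact
        obtain ⟨u, hu, v, hv, huv, hne⟩ := hexact
        have h1 : ¬ F.Adj u v ∧ G.Adj (g' u) (g' v) := by
          have := c4 u hu v hv (by tauto)
          tauto
        have hrel2 := eN_rel_lt F G g' W (W ∪ V0) Finset.subset_union_left c1 c4 hu hv (by tauto)
          h1.1 h1.2
        rw [hWim, ← hC] at hrel2
        exact extra (by omega)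
      have hgen : ¬ Generic α D G (W.image g) C := fun hgen => hcon ⟨g', c1, c2, hexact, hgen⟩
      unfold Generic at hgen
      push Not at hgen
      obtain ⟨T, hCT, hTc, hrig, u, huT, huC, v, hvC, hvW, huv⟩ := hgen
      by_cases hTX : T ⊆ X ∪ C
      · have huX : u ∈ X := (Finset.mem_union.1 (hTX huT)).resolve_right huC
        have hvX : v ∉ X := by
          intro hvX
          apply hvW
          rw [← hXC]
          exact Finset.mem_inter.2 ⟨hvX, hvC⟩
        have hsup2 := eN_super_edge G X C huX huC hvC hvX huv
        rw [hXC] at hsup2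
        exact extra (by omega)
      · set T1 := (X ∪ C) ∩ T with hT1
        have hCT1 : C ⊆ T1 := Finset.subset_inter Finset.subset_union_right hCT
        have hT1T : T1 ⊆ T := Finset.inter_subset_right
        have hlt := hrig T1 hCT1 hT1T (by
          intro h
          apply hTX
          rw [← h]
          exact Finset.inter_subset_left)
        have hc1 := Finset.card_le_card hT1T
        have hc2 := Finset.card_le_card hCT1
        have hm := eN_mono (G := G) hT1T
        have hd := hδ (T.card - T1.card) (by omega) (eN G T - eN G T1) (by
          rw [Nat.cast_sub hc1, Nat.cast_sub hm]
          unfold fR at hlt; linarith)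
        rw [Nat.cast_sub hc1, Nat.cast_sub hm] at hd
        have hsup2 := eN_super G (X ∪ C) T
        rw [← hT1] at hsup2
        have hTX' : (T \ (X ∪ C)).card = T.card - T1.card := by
          rw [Finset.card_sdiff, ← hT1]
        have hun : (P ∪ H) ∪ (Q ∪ T \ (X ∪ C)) = (X ∪ C) ∪ T := by
          rw [← Finset.union_assoc, ← hXCH, Finset.union_sdiff_self_eq_union]
        have hdd : Disjoint ((P ∪ H) ∪ Q) (T \ (X ∪ C)) := by
          rw [← hXCH]; exact Finset.disjoint_sdiff
        rw [Finset.disjoint_union_left] at hdd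
        have hQc : (Q ∪ T \ (X ∪ C)).card = Q.card + (T.card - T1.card) := by
          rw [Finset.card_union_of_disjoint hdd.2, hTX']
        refine ⟨P ∪ H, Q ∪ T \ (X ∪ C), Finset.union_subset hP hHB, ?_, ?_, ?_, ?_⟩
        · rw [Finset.disjoint_union_right]
          exact ⟨hPHQ, hdd.1⟩
        · have := hcard V0
          rw [hPH, hQc, Nat.succ_mul]; omega
        · rw [hun]
          exact hWPQ.trans (Finset.subset_union_left.trans Finset.subset_union_left)
        · have hs' : (eN F (W ∪ V0) + eN G X + eN G T : ℝ) ≤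
              eN G ((X ∪ C) ∪ T) + eN F W + eN G T1 := by
            exact_mod_cast (by omega)
          have := mul_le_mul_of_nonneg_left hs' hα.le
          unfold Phi at hPhi ⊢
          rw [hun, hPH, hQc]
          push_cast
          rw [Nat.cast_sub hc1]
          have e1 : (w+η)*((P.card:ℝ)+V0.card) = (w+η)*P.card + w*V0.card + η*V0.card := by ring
          linarith
  obtain ⟨P, Q, h1, h2, h3, -, h5⟩ := key L le_rfl
  have := hN P h1 Q h2 h3
  linarith

lemma exists_V0 {α : ℝ} (hα : 0 < α) {t : ℕ} (F : SimpleGraph (Fin t)) {W U : Finset (Fin t)}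
    (hWU : W ⊆ U) (hne : W ≠ U) (hs : Safe α F W U) :
    ∃ V0 : Finset (Fin t), ∃ w : ℝ, V0.Nonempty ∧ V0 ⊆ U ∧ Disjoint W V0 ∧ 0 ≤ w ∧ w < 1 ∧
      w * V0.card = α * (eN F (W ∪ V0) - eN F W) ∧
      (∀ S ⊆ V0, α * (eN F (W ∪ S) - eN F W) ≤ w * S.card) ∧ Safe α F (W ∪ V0) U := by
  let ρ : Finset (Fin t) → ℝ := fun S => α * (eN F (W ∪ S) - eN F W) / S.card
  have hnon : (((U \ W).powerset.filter (·.Nonempty))).Nonempty := by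
    refine ⟨U \ W, ?_⟩
    simp only [Finset.mem_filter, Finset.mem_powerset, subset_refl, true_and]
    rw [Finset.sdiff_nonempty]
    exact fun h => hne (Finset.Subset.antisymm hWU h)
  obtain ⟨V0, h1, h2⟩ := Finset.exists_max_image _ ρ hnon
  simp only [Finset.mem_filter, Finset.mem_powerset] at h1 h2
  have hdis : ∀ S ⊆ U \ W, Disjoint W S := by
    intro S hS
    rw [Finset.disjoint_right]
    intro a ha; exact (Finset.mem_sdiff.1 (hS ha)).2
  have hpos : (0:ℝ) < V0.card := by exact_mod_cast h1.2.card_pos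
  have hVU : V0 ⊆ U := h1.1.trans Finset.sdiff_subset
  have hm := fun S : Finset (Fin t) =>
    eN_mono (G := F) (Finset.subset_union_left : W ⊆ W ∪ S)
  have hm' : ∀ S : Finset (Fin t), (0:ℝ) ≤ eN F (W ∪ S) - eN F W := by
    intro S
    have : (eN F W : ℝ) ≤ eN F (W ∪ S) := by exact_mod_cast hm S
    linarith
  have heq : ρ V0 * V0.card = α * (eN F (W ∪ V0) - eN F W) := by
    simp only [ρ]; field_simp
  have hle : ∀ S ⊆ U \ W, α * (eN F (W ∪ S) - eN F W) ≤ ρ V0 * S.card := by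
    intro S hS
    by_cases hSe : S.Nonempty
    · have := h2 S ⟨hS, hSe⟩
      have hp : (0:ℝ) < S.card := by exact_mod_cast hSe.card_pos
      simp only [ρ] at this ⊢
      rwa [div_le_iff₀ hp] at this
    · rw [Finset.not_nonempty_iff_eq_empty] at hSe
      subst hSe; simp
  have hlt1 : ρ V0 < 1 := by
    simp only [ρ]
    rw [div_lt_one hpos]
    have := hs (W ∪ V0) Finset.subset_union_left (Finset.union_subset hWU hVU) (by
      intro h
      obtain ⟨a, ha⟩ := h1.2
      have h3 : a ∈ W := by rw [← h]; exact Finset.mem_union_right _ ha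
      exact Finset.disjoint_left.1 (hdis V0 h1.1) h3 ha)
    unfold fR at this
    rw [Finset.card_union_of_disjoint (hdis V0 h1.1)] at this
    push_cast at this
    linarith
  refine ⟨V0, ρ V0, h1.2, hVU, hdis V0 h1.1, ?_, hlt1, heq, fun S hS => hle S (hS.trans h1.1), ?_⟩
  · simp only [ρ]
    have := hm' V0
    positivity
  · intro S hS1 hS2 hS3
    have e1 : W ∪ (S \ W) = S :=
      Finset.union_sdiff_of_subset (Finset.subset_union_left.trans hS1)
    have h3 := hle (S \ W) (Finset.sdiff_subset_sdiff hS2 subset_rfl)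
    rw [e1] at h3
    have h4 : (S \ W).card + W.card = S.card :=
      Finset.card_sdiff_add_card_eq_card (Finset.subset_union_left.trans hS1)
    have h5 := Finset.card_lt_card (Finset.ssubset_iff_subset_ne.2 ⟨hS1, hS3.symm⟩)
    have h6 := Finset.card_union_of_disjoint (hdis V0 h1.1)
    have h4' : ((S \ W).card : ℝ) + W.card = S.card := by exact_mod_cast h4
    have h5' : ((W ∪ V0).card : ℝ) < S.card := by exact_mod_cast h5
    have h6' : ((W ∪ V0).card : ℝ) = W.card + V0.card := by exact_mod_cast h6
    unfold fR
    nlinarith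

end Step
end RandomGraphSpectra

namespace RandomGraphSpectra

section Prob
variable {E : Type*} [Fintype E] [DecidableEq E]

/-- Bernoulli weight. -/
noncomputable def bw (p : ℝ) (b : Bool) : ℝ := if b = true then p else 1 - p

lemma bw_nonneg {p : ℝ} (h0 : 0 ≤ p) (h1 : p ≤ 1) (b : Bool) : 0 ≤ bw p b := by
  unfold bw; split_ifs <;> linarith

/-- Product weight. -/
noncomputable def pw (p : ℝ) (ω : E → Bool) : ℝ := ∏ e, bw p (ω e)

lemma pw_nonneg {p : ℝ} (h0 : 0 ≤ p) (h1 : p ≤ 1) (ω : E → Bool) : 0 ≤ pw p ω :=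
  Finset.prod_nonneg fun _ _ => bw_nonneg h0 h1 _

/-- Expectation in the product model. -/
noncomputable def Ex (p : ℝ) (X : (E → Bool) → ℝ) : ℝ := ∑ ω, pw p ω * X ω

open Classical in
/-- Probability in the product model. -/
noncomputable def Pr (p : ℝ) (A : (E → Bool) → Prop) : ℝ := Ex p (fun ω => if A ω then 1 else 0)

lemma Ex_prod (p : ℝ) (f : E → Bool → ℝ) :
    Ex p (fun ω => ∏ e, f e (ω e)) = ∏ e, (p * f e true + (1 - p) * f e false) := by
  have := Finset.prod_univ_sum (fun _ : E => (Finset.univ : Finset Bool)) (fun e b => bw p b * f e b)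
  simp only [Fintype.piFinset_univ] at this
  unfold Ex pw
  simp only [← Finset.prod_mul_distrib]
  rw [← this]
  refine Finset.prod_congr rfl fun e _ => ?_
  simp [bw]

lemma Ex_one (p : ℝ) : Ex (E := E) p (fun _ => 1) = 1 := by
  have := Ex_prod (E := E) p (fun _ _ => 1)
  simpa using this

lemma Ex_edges (p : ℝ) (S : Finset E) :
    Ex p (fun ω => if ∀ e ∈ S, ω e = true then 1 else 0) = p ^ S.card := by
  have := Ex_prod (E := E) p (fun e b => if e ∈ S then (if b = true then 1 else 0) else 1)
  have h2 : ∀ ω : E → Bool, (∏ e, if e ∈ S then (if ω e = true then (1:ℝ) else 0) else 1) =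
      if ∀ e ∈ S, ω e = true then 1 else 0 := by
    intro ω
    by_cases h : ∀ e ∈ S, ω e = true
    · rw [if_pos h]
      refine Finset.prod_eq_one fun e _ => ?_
      by_cases he : e ∈ S
      · simp [he, h e he]
      · simp [he]
    · rw [if_neg h]
      push Not at h
      obtain ⟨e, he, h⟩ := h
      refine Finset.prod_eq_zero (Finset.mem_univ e) ?_
      simp [he, h]
  simp only [h2] at this
  rw [this]
  calc _ = ∏ e, (if e ∈ S then p else 1) := by
        refine Finset.prod_congr rfl fun e _ => ?_
        by_cases he : e ∈ S <;> simp [he]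
    _ = _ := by rw [Finset.prod_ite_mem]; simp

lemma Ex_add (p : ℝ) (X Y : (E → Bool) → ℝ) : Ex p (fun ω => X ω + Y ω) = Ex p X + Ex p Y := by
  simp only [Ex, mul_add, Finset.sum_add_distrib]

lemma Ex_sub (p : ℝ) (X Y : (E → Bool) → ℝ) : Ex p (fun ω => X ω - Y ω) = Ex p X - Ex p Y := by
  simp only [Ex, mul_sub, Finset.sum_sub_distrib]

lemma Ex_const_mul (p c : ℝ) (X : (E → Bool) → ℝ) : Ex p (fun ω => c * X ω) = c * Ex p X := by
  simp only [Ex, Finset.mul_sum]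
  exact Finset.sum_congr rfl fun _ _ => by ring

lemma Ex_sum {ι : Type*} (p : ℝ) (s : Finset ι) (X : ι → (E → Bool) → ℝ) :
    Ex p (fun ω => ∑ i ∈ s, X i ω) = ∑ i ∈ s, Ex p (X i) := by
  simp only [Ex, Finset.mul_sum]
  exact Finset.sum_comm

lemma Ex_mono {p : ℝ} (h0 : 0 ≤ p) (h1 : p ≤ 1) {X Y : (E → Bool) → ℝ} (h : ∀ ω, X ω ≤ Y ω) :
    Ex p X ≤ Ex p Y :=
  Finset.sum_le_sum fun ω _ => mul_le_mul_of_nonneg_left (h ω) (pw_nonneg h0 h1 ω)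

lemma Pr_mono {p : ℝ} (h0 : 0 ≤ p) (h1 : p ≤ 1) {A B : (E → Bool) → Prop} (h : ∀ ω, A ω → B ω) :
    Pr p A ≤ Pr p B := by
  refine Ex_mono h0 h1 fun ω => ?_
  by_cases hA : A ω
  · simp [hA, h ω hA]
  · simp only [hA, if_false]
    split_ifs <;> norm_num

lemma Pr_nonneg {p : ℝ} (h0 : 0 ≤ p) (h1 : p ≤ 1) (A : (E → Bool) → Prop) : 0 ≤ Pr p A := by
  refine Finset.sum_nonneg fun ω _ => mul_nonneg (pw_nonneg h0 h1 ω) ?_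
  dsimp only
  split_ifs <;> norm_num

lemma Pr_compl (p : ℝ) (A : (E → Bool) → Prop) : Pr p (fun ω => ¬ A ω) = 1 - Pr p A := by
  classical
  have h2 := Ex_sub p (fun _ => (1:ℝ)) (fun ω => if A ω then (1:ℝ) else 0)
  rw [Ex_one] at h2
  unfold Pr
  rw [← h2]
  congr 1
  funext ω
  by_cases hA : A ω <;> simp [hA]

lemma Pr_le_one {p : ℝ} (h0 : 0 ≤ p) (h1 : p ≤ 1) (A : (E → Bool) → Prop) : Pr p A ≤ 1 := by
  have := Pr_compl p A
  have := Pr_nonneg h0 h1 (fun ω => ¬ A ω)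
  linarith

lemma Pr_union {ι : Type*} {p : ℝ} (h0 : 0 ≤ p) (h1 : p ≤ 1) (s : Finset ι)
    (A : ι → (E → Bool) → Prop) :
    Pr p (fun ω => ∃ i ∈ s, A i ω) ≤ ∑ i ∈ s, Pr p (A i) := by
  classical
  unfold Pr
  rw [← Ex_sum]
  refine Ex_mono h0 h1 fun ω => ?_
  by_cases h : ∃ i ∈ s, A i ω
  · obtain ⟨i, hi, hA⟩ := h
    rw [if_pos ⟨i, hi, hA⟩]
    have := Finset.single_le_sum (f := fun i => if A i ω then (1:ℝ) else 0)
      (fun i _ => by split_ifs <;> norm_num) hi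
    simpa [hA] using this
  · rw [if_neg h]
    exact Finset.sum_nonneg fun i _ => by split_ifs <;> norm_num

lemma Pr_or {p : ℝ} (h0 : 0 ≤ p) (h1 : p ≤ 1) (A B : (E → Bool) → Prop) :
    Pr p (fun ω => A ω ∨ B ω) ≤ Pr p A + Pr p B := by
  classical
  unfold Pr
  rw [← Ex_add]
  refine Ex_mono h0 h1 fun ω => ?_
  by_cases hA : A ω <;> by_cases hB : B ω <;> simp [hA, hB]

/-- `X` only depends on the coordinates in `S`. -/
def DepOn (S : Set E) {β : Type*} (X : (E → Bool) → β) : Prop :=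
  ∀ ω ω' : E → Bool, (∀ e ∈ S, ω e = ω' e) → X ω = X ω'

lemma Ex_indep (p : ℝ) (S : Set E) {X Y : (E → Bool) → ℝ} (hX : DepOn S X) (hY : DepOn Sᶜ Y) :
    Ex p (fun ω => X ω * Y ω) = Ex p X * Ex p Y := by
  classical
  let mix : (E → Bool) → (E → Bool) → (E → Bool) := fun a b e => if e ∈ S then a e else b e
  have hinv : Function.Involutive (fun x : (E → Bool) × (E → Bool) => (mix x.1 x.2, mix x.2 x.1)) := by
    rintro ⟨a, b⟩
    simp only [mix, Prod.mk.injEq]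
    constructor <;> funext e <;> by_cases he : e ∈ S <;> simp [he]
  have key := Equiv.sum_comp (hinv.toPerm _)
    (fun x : (E → Bool) × (E → Bool) => (pw p x.1 * X x.1) * (pw p x.2 * Y x.2))
  have e1 : Ex p X * Ex p Y = ∑ x : (E → Bool) × (E → Bool), (pw p x.1 * X x.1) * (pw p x.2 * Y x.2) := by
    unfold Ex
    rw [Fintype.sum_mul_sum, Fintype.sum_prod_type]
  have e2 : Ex p (fun ω => X ω * Y ω) * Ex (E := E) p (fun _ => 1) =
      ∑ x : (E → Bool) × (E → Bool), (pw p x.1 * (X x.1 * Y x.1)) * (pw p x.2 * 1) := by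
    unfold Ex
    rw [Fintype.sum_mul_sum, Fintype.sum_prod_type]
  rw [Ex_one, mul_one] at e2
  rw [e1, e2, ← key]
  refine Finset.sum_congr rfl fun x _ => ?_
  obtain ⟨a, b⟩ := x
  simp only [Function.Involutive.coe_toPerm]
  have h1 : X (mix a b) = X a := hX _ _ fun e he => by simp [mix, he]
  have h2 : Y (mix b a) = Y a := hY _ _ fun e he => by
    have : e ∉ S := he
    simp [mix, this]
  have h3 : pw p (mix a b) * pw p (mix b a) = pw p a * pw p b := by
    unfold pw
    rw [← Finset.prod_mul_distrib, ← Finset.prod_mul_distrib]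
    refine Finset.prod_congr rfl fun e _ => ?_
    by_cases he : e ∈ S
    · simp [mix, he]
    · simp [mix, he, mul_comm]
  rw [h1, h2]
  linear_combination (-(X a * Y a)) * h3

lemma Pr_indep_all {ι : Type*} (p : ℝ) (J : Finset ι) (S : ι → Set E)
    (hS : ∀ i ∈ J, ∀ j ∈ J, i ≠ j → Disjoint (S i) (S j))
    (A : ι → (E → Bool) → Prop) (hA : ∀ i ∈ J, DepOn (S i) (A i)) :
    Pr p (fun ω => ∀ i ∈ J, A i ω) = ∏ i ∈ J, Pr p (A i) := by
  classical
  induction J using Finset.induction_on with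
  | empty => simp [Pr, Ex_one]
  | insert j J hj ih =>
    rw [Finset.prod_insert hj, ← ih (fun i hi k hk => hS i (Finset.mem_insert_of_mem hi) k
      (Finset.mem_insert_of_mem hk)) (fun i hi => hA i (Finset.mem_insert_of_mem hi))]
    unfold Pr
    rw [← Ex_indep p (S j)]
    · congr 1
      funext ω
      by_cases h1 : A j ω <;> by_cases h2 : ∀ i ∈ J, A i ω <;> simp [h1, h2]
    · intro ω ω' h
      have := hA j (Finset.mem_insert_self _ _) ω ω' h
      simp only [this]
    · intro ω ω' h
      have : (∀ i ∈ J, A i ω) ↔ (∀ i ∈ J, A i ω') := by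
        refine forall₂_congr fun i hi => ?_
        rw [hA i (Finset.mem_insert_of_mem hi) ω ω' fun e he => h e ?_]
        have := hS i (Finset.mem_insert_of_mem hi) j (Finset.mem_insert_self _ _)
          (fun h => hj (h ▸ hi))
        exact fun hh => Set.disjoint_left.1 this he hh
      dsimp only
      by_cases h1 : ∀ i ∈ J, A i ω
      · rw [if_pos h1, if_pos (this.1 h1)]
      · rw [if_neg h1, if_neg (fun h2 => h1 (this.2 h2))]

end Prob

/-- Potential edges. -/
abbrev PE (n : ℕ) := {e : Sym2 (Fin n) // ¬ e.IsDiag}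

/-- graph of an outcome -/
def gr {n : ℕ} (ω : PE n → Bool) : SimpleGraph (Fin n) where
  Adj a b := ∃ h : ¬ (s(a, b)).IsDiag, ω ⟨s(a, b), h⟩ = true
  symm := ⟨by
    rintro a b ⟨h, h2⟩
    have e : s(b, a) = s(a, b) := Sym2.eq_swap
    refine ⟨by rw [e]; exact h, ?_⟩
    simp only [e, h2]⟩
  loopless := ⟨by
    rintro a ⟨h, _⟩
    exact h (by simp)⟩

lemma gr_mem {n : ℕ} (ω : PE n → Bool) (e : PE n) : e.1 ∈ (gr ω).edgeSet ↔ ω e = true := by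
  obtain ⟨e, he⟩ := e
  induction e using Sym2.ind with
  | _ a b =>
    rw [SimpleGraph.mem_edgeSet]
    constructor
    · rintro ⟨_, h⟩; exact h
    · intro h; exact ⟨he, h⟩

lemma gr_bij (n : ℕ) : Function.Bijective (gr (n := n)) := by
  classical
  constructor
  · intro ω ω' h
    funext e
    have h1 := gr_mem ω e
    have h2 := gr_mem ω' e
    rw [h] at h1
    rw [Bool.eq_iff_iff, ← h1, h2]
  · intro G
    refine ⟨fun e => decide (e.1 ∈ G.edgeSet), ?_⟩
    rw [← SimpleGraph.edgeSet_inj]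
    ext e
    by_cases he : e.IsDiag
    · exact ⟨fun h => absurd he (SimpleGraph.not_isDiag_of_mem_edgeSet _ h),
        fun h => absurd he (SimpleGraph.not_isDiag_of_mem_edgeSet _ h)⟩
    · rw [gr_mem _ ⟨e, he⟩]; simp

lemma edgeCount_gr {n : ℕ} (ω : PE n → Bool) :
    edgeCount (gr ω) = (Finset.univ.filter fun e => ω e = true).card := by
  classical
  unfold edgeCount
  rw [← Fintype.card_subtype, ← Nat.card_eq_fintype_card]
  refine Nat.card_congr ⟨fun e => ⟨⟨e.1, SimpleGraph.not_isDiag_of_mem_edgeSet _ e.2⟩,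
    (gr_mem ω _).1 e.2⟩, fun e => ⟨e.1.1, (gr_mem ω _).2 e.2⟩, fun _ => rfl, fun _ => rfl⟩

lemma weight_gr {n : ℕ} (p : ℝ) (ω : PE n → Bool) : weight n p (gr ω) = pw p ω := by
  classical
  unfold weight pw bw
  rw [Finset.prod_ite, Finset.prod_const, Finset.prod_const, edgeCount_gr]
  congr 2
  have h1 : Fintype.card (PE n) = n.choose 2 := by
    rw [Sym2.card_subtype_not_diag, Fintype.card_fin]
  rw [← h1, ← Finset.card_univ, Finset.filter_not, Finset.card_sdiff_of_subset (Finset.filter_subset _ _)]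

lemma probPred_eq (n : ℕ) (p : ℝ) (P : SimpleGraph (Fin n) → Prop) :
    probPred n p P = Pr p (fun ω : PE n → Bool => P (gr ω)) := by
  classical
  unfold probPred Pr Ex
  rw [finsum_eq_sum_of_fintype, ← (gr_bij n).sum_comp]
  refine Finset.sum_congr rfl fun ω _ => ?_
  rw [weight_gr]
  by_cases h : P (gr ω) <;> simp [h]

end RandomGraphSpectra

namespace RandomGraphSpectra

lemma pn_nonneg (α : ℝ) (n : ℕ) : 0 ≤ (n : ℝ) ^ (-α) := Real.rpow_nonneg (Nat.cast_nonneg _) _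

lemma pn_le_one {α : ℝ} (hα : 0 < α) (n : ℕ) : (n : ℝ) ^ (-α) ≤ 1 := by
  rcases Nat.eq_zero_or_pos n with h | h
  · subst h
    rw [Nat.cast_zero, Real.zero_rpow (by linarith)]; norm_num
  · exact Real.rpow_le_one_of_one_le_of_nonpos (by exact_mod_cast h) (by linarith)

/-- with high probability -/
def Whp (α : ℝ) (P : ∀ n, SimpleGraph (Fin n) → Prop) : Prop :=
  Tendsto (fun n : ℕ => Pr ((n : ℝ) ^ (-α)) (fun ω : PE n → Bool => ¬ P n (gr ω))) atTop (𝓝 0)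

lemma whp_of_bound {α : ℝ} (hα : 0 < α) {P : ∀ n, SimpleGraph (Fin n) → Prop} {f : ℕ → ℝ}
    (hf : Tendsto f atTop (𝓝 0))
    (h : ∀ᶠ n : ℕ in atTop, Pr ((n : ℝ) ^ (-α)) (fun ω : PE n → Bool => ¬ P n (gr ω)) ≤ f n) :
    Whp α P :=
  tendsto_of_tendsto_of_tendsto_of_le_of_le' tendsto_const_nhds hf
    (Eventually.of_forall fun n => Pr_nonneg (pn_nonneg α n) (pn_le_one hα n) _) h

lemma Whp.mono {α : ℝ} (hα : 0 < α) {P Q : ∀ n, SimpleGraph (Fin n) → Prop} (hP : Whp α P)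
    (h : ∀ᶠ n : ℕ in atTop, ∀ G, P n G → Q n G) : Whp α Q :=
  whp_of_bound hα hP (h.mono fun n hn =>
    Pr_mono (pn_nonneg α n) (pn_le_one hα n) fun ω h1 h2 => h1 (hn _ h2))

lemma whp_true {α : ℝ} (hα : 0 < α) {P : ∀ n, SimpleGraph (Fin n) → Prop} (h : ∀ n G, P n G) :
    Whp α P := by
  refine whp_of_bound hα tendsto_const_nhds (Eventually.of_forall fun n => ?_)
  have : Pr ((n : ℝ) ^ (-α)) (fun ω : PE n → Bool => ¬ P n (gr ω)) = 0 := by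
    simp [Pr, Ex, h]
  exact this.le

lemma Whp.and {α : ℝ} (hα : 0 < α) {P Q : ∀ n, SimpleGraph (Fin n) → Prop} (hP : Whp α P)
    (hQ : Whp α Q) : Whp α (fun n G => P n G ∧ Q n G) := by
  have hPQ := Tendsto.add hP hQ
  rw [add_zero] at hPQ
  refine whp_of_bound hα hPQ (Eventually.of_forall fun n => ?_)
  refine (Pr_mono (pn_nonneg α n) (pn_le_one hα n) ?_).trans
    (Pr_or (pn_nonneg α n) (pn_le_one hα n) _ _)
  intro ω h
  tauto

lemma Whp.finset {α : ℝ} (hα : 0 < α) {ι : Type*} (s : Finset ι)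
    {P : ι → ∀ n, SimpleGraph (Fin n) → Prop} (h : ∀ i ∈ s, Whp α (P i)) :
    Whp α (fun n G => ∀ i ∈ s, P i n G) := by
  classical
  induction s using Finset.induction_on with
  | empty => exact whp_true hα (by simp)
  | insert a s ha ih =>
    refine Whp.mono hα ((h a (Finset.mem_insert_self _ _)).and hα
      (ih fun i hi => h i (Finset.mem_insert_of_mem hi))) (Eventually.of_forall fun n G hh => ?_)
    intro i hi
    rcases Finset.mem_insert.1 hi with rfl | hi
    · exact hh.1
    · exact hh.2 i hi

lemma Whp.fintype {α : ℝ} (hα : 0 < α) {ι : Type*} [Finite ι]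
    {P : ι → ∀ n, SimpleGraph (Fin n) → Prop} (h : ∀ i, Whp α (P i)) :
    Whp α (fun n G => ∀ i, P i n G) := by
  have := Fintype.ofFinite ι
  exact (Whp.finset hα Finset.univ fun i _ => h i).mono hα
    (Eventually.of_forall fun n G hh i => hh i (Finset.mem_univ _))

/-- Pattern edges. -/
noncomputable def pat {t n : ℕ} (F : SimpleGraph (Fin t)) (W U : Finset (Fin t))
    (φ : Fin t → Fin n) : Finset (PE n) :=
  ((edgesIn F U \ edgesIn F W).image (Sym2.map φ)).subtype _

lemma mem_pat {t n : ℕ} {F : SimpleGraph (Fin t)} {W U : Finset (Fin t)}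
    {φ : Fin t → Fin n} {e : PE n} : e ∈ pat F W U φ ↔
      ∃ u ∈ U, ∃ v ∈ U, ¬ (u ∈ W ∧ v ∈ W) ∧ F.Adj u v ∧ e.1 = s(φ u, φ v) := by
  unfold pat
  rw [Finset.mem_subtype, Finset.mem_image]
  constructor
  · rintro ⟨e', he', h⟩
    induction e' using Sym2.ind with
    | _ a b =>
      rw [Finset.mem_sdiff, mk_mem_edgesIn, mk_mem_edgesIn] at he'
      exact ⟨a, he'.1.1.1, b, he'.1.1.2, fun hh => he'.2 ⟨hh, he'.1.2⟩, he'.1.2, by rw [← h]; simp⟩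
  · rintro ⟨u, hu, v, hv, huv, hF, he⟩
    refine ⟨s(u, v), ?_, by rw [he]; simp⟩
    rw [Finset.mem_sdiff, mk_mem_edgesIn, mk_mem_edgesIn]
    exact ⟨⟨⟨hu, hv⟩, hF⟩, fun hh => huv hh.1⟩

lemma card_pat {t n : ℕ} (F : SimpleGraph (Fin t)) {W U : Finset (Fin t)} (hWU : W ⊆ U)
    {φ : Fin t → Fin n} (hφ : Set.InjOn φ U) : (pat F W U φ).card + eN F W = eN F U := by
  rw [← card_rel_image F φ W U hWU hφ]
  unfold pat
  rw [Finset.card_subtype, Finset.filter_true_of_mem]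
  intro e he
  rw [Finset.mem_image] at he
  obtain ⟨e', he', rfl⟩ := he
  induction e' using Sym2.ind with
  | _ a b =>
    rw [Finset.mem_sdiff, mk_mem_edgesIn] at he'
    simp only [Sym2.map_mk, Sym2.isDiag_iff_proj_eq]
    exact fun h => he'.1.2.ne (hφ he'.1.1.1 he'.1.1.2 h)

lemma pat_iff {t n : ℕ} (F : SimpleGraph (Fin t)) {W U : Finset (Fin t)}
    {φ : Fin t → Fin n} (hφ : Set.InjOn φ U) (ω : PE n → Bool) :
    (∀ e ∈ pat F W U φ, ω e = true) ↔
    ∀ u ∈ U, ∀ v ∈ U, ¬ (u ∈ W ∧ v ∈ W) → F.Adj u v → (gr ω).Adj (φ u) (φ v) := by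
  constructor
  · intro h u hu v hv huv hF
    have hd : ¬ (s(φ u, φ v)).IsDiag := by
      simp only [Sym2.isDiag_iff_proj_eq]
      exact fun h => hF.ne (hφ hu hv h)
    exact ⟨hd, h ⟨_, hd⟩ (mem_pat.2 ⟨u, hu, v, hv, huv, hF, rfl⟩)⟩
  · rintro h ⟨e, he⟩ hm
    obtain ⟨u, hu, v, hv, huv, hF, hh⟩ := mem_pat.1 hm
    have := h u hu v hv huv hF
    rw [← SimpleGraph.mem_edgeSet, ← hh, gr_mem ω ⟨e, he⟩] at this
    exact this

lemma Pr_edges {E : Type*} [Fintype E] [DecidableEq E] (p : ℝ) (S : Finset E) :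
    Pr p (fun ω => ∀ e ∈ S, ω e = true) = p ^ S.card := by
  rw [← Ex_edges]
  unfold Pr
  congr 1
  funext ω
  by_cases h : ∀ e ∈ S, ω e = true
  · rw [if_pos h, if_pos h]
  · rw [if_neg h, if_neg h]

lemma first_moment {α w : ℝ} (hα : 0 < α) {B : ∀ n, Finset (Fin n)}
    (hB : ∀ᶠ n : ℕ in atTop, ((B n).card : ℝ) ≤ (n : ℝ) ^ w) {v : ℕ} (F : SimpleGraph (Fin v))
    (L : Finset (Fin v)) (hneg : w * L.card + ((v : ℝ) - L.card) - α * eN F Finset.univ < 0) :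
    Whp α (fun n G => ¬ ∃ g : Fin v → Fin n, Function.Injective g ∧ (∀ i ∈ L, g i ∈ B n) ∧
      ∀ i j, F.Adj i j → G.Adj (g i) (g j)) := by
  set c := w * L.card + ((v : ℝ) - L.card) - α * eN F Finset.univ with hc
  have hlim : Tendsto (fun n : ℕ => (n : ℝ) ^ c) atTop (𝓝 0) := by
    have := (tendsto_rpow_neg_atTop (y := -c) (by linarith)).comp (tendsto_natCast_atTop_atTop (R := ℝ))
    simpa [Function.comp_def] using this
  refine whp_of_bound hα hlim ?_
  filter_upwards [hB, eventually_ge_atTop 1] with n hn hn1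
  have hp0 := pn_nonneg α n
  have hp1 := pn_le_one hα n
  have hnpos : (0:ℝ) < n := by exact_mod_cast hn1
  set Gs : Finset (Fin v → Fin n) :=
    Fintype.piFinset (fun i => if i ∈ L then B n else Finset.univ) with hGs
  have h1 : Pr ((n : ℝ) ^ (-α)) (fun ω : PE n → Bool => ¬ ¬ ∃ g : Fin v → Fin n,
      Function.Injective g ∧ (∀ i ∈ L, g i ∈ B n) ∧
      ∀ i j, F.Adj i j → (gr ω).Adj (g i) (g j)) ≤
      ∑ g ∈ Gs.filter Function.Injective, Pr ((n : ℝ) ^ (-α)) (fun ω : PE n → Bool =>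
        ∀ e ∈ pat F ∅ Finset.univ g, ω e = true) := by
    refine (Pr_mono hp0 hp1 ?_).trans (Pr_union hp0 hp1 _ _)
    intro ω h
    rw [not_not] at h
    obtain ⟨g, hg1, hg2, hg3⟩ := h
    refine ⟨g, ?_, ?_⟩
    · rw [Finset.mem_filter, hGs, Fintype.mem_piFinset]
      refine ⟨fun i => ?_, hg1⟩
      by_cases hi : i ∈ L
      · simp [hi, hg2 i hi]
      · simp [hi]
    · rw [pat_iff F (hg1.injOn)]
      intro u _ v _ _ h
      exact hg3 u v h
  refine h1.trans ?_
  have h2 : ∀ g ∈ Gs.filter Function.Injective, Pr ((n : ℝ) ^ (-α)) (fun ω : PE n → Bool =>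
        ∀ e ∈ pat F ∅ Finset.univ g, ω e = true) = ((n : ℝ) ^ (-α)) ^ (eN F Finset.univ) := by
    intro g hg
    rw [Finset.mem_filter] at hg
    rw [Pr_edges, ← card_pat F (Finset.empty_subset _) (hg.2.injOn (s := (Finset.univ : Finset (Fin v)))),
      eN_empty, add_zero]
  rw [Finset.sum_congr rfl h2, Finset.sum_const, nsmul_eq_mul]
  have h3 : ((Gs.filter Function.Injective).card : ℝ) ≤ (B n).card ^ L.card * (n:ℝ) ^ (v - L.card) := by
    have h4 : (Gs.filter Function.Injective).card ≤ Gs.card := Finset.card_filter_le _ _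
    have h5 : Gs.card = (B n).card ^ L.card * n ^ (v - L.card) := by
      rw [hGs, Fintype.card_piFinset]
      have : ∀ i : Fin v, (if i ∈ L then B n else Finset.univ).card = if i ∈ L then (B n).card else n := by
        intro i; split_ifs <;> simp
      simp only [this]
      rw [Finset.prod_ite, Finset.prod_const, Finset.prod_const]
      congr 2
      · simp
      · rw [Finset.filter_not, Finset.card_sdiff_of_subset (Finset.filter_subset _ _)]
        simp
    rw [h5] at h4
    exact_mod_cast h4
  have hLv : L.card ≤ v := by simpa using Finset.card_le_univ L
  calc _ ≤ (((n:ℝ) ^ w) ^ L.card * (n:ℝ) ^ (v - L.card)) * ((n : ℝ) ^ (-α)) ^ (eN F Finset.univ) := by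
        gcongr
        refine h3.trans ?_
        gcongr
    _ = (n:ℝ) ^ c := by
        rw [← Real.rpow_natCast (((n:ℝ) ^ w)), ← Real.rpow_natCast ((n:ℝ)),
          ← Real.rpow_natCast (((n:ℝ) ^ (-α))), ← Real.rpow_mul hnpos.le, ← Real.rpow_mul hnpos.le,
          ← Real.rpow_add hnpos, ← Real.rpow_add hnpos, hc]
        congr 1
        rw [Nat.cast_sub hLv]
        ring

lemma whp_N2 {α w : ℝ} (hα : 0 < α) {B : ∀ n, Finset (Fin n)}
    (hB : ∀ᶠ n : ℕ in atTop, ((B n).card : ℝ) ≤ (n : ℝ) ^ w) (M : ℕ) :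
    Whp α (fun n G => N2 α w G (B n) M) := by
  classical
  have key : Whp α (fun n G => ∀ x : (Σ v : Fin (M + 1), SimpleGraph (Fin v) × Finset (Fin v)),
      (w * x.2.2.card + (((x.1 : ℕ) : ℝ) - x.2.2.card) - α * eN x.2.1 Finset.univ < 0) →
      ¬ ∃ g : Fin x.1 → Fin n, Function.Injective g ∧ (∀ i ∈ x.2.2, g i ∈ B n) ∧
      ∀ i j, x.2.1.Adj i j → G.Adj (g i) (g j)) := by
    refine Whp.fintype hα fun x => ?_
    by_cases hx : w * x.2.2.card + (((x.1 : ℕ) : ℝ) - x.2.2.card) - α * eN x.2.1 Finset.univ < 0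
    · exact (first_moment hα hB x.2.1 x.2.2 hx).mono hα (Eventually.of_forall fun n G h _ => h)
    · exact whp_true hα fun n G h => absurd h hx
  refine key.mono hα (Eventually.of_forall fun n G h => ?_)
  intro P hP Q hPQ hc
  by_contra hcon
  push Not at hcon
  have hv : (P ∪ Q).card = P.card + Q.card := Finset.card_union_of_disjoint hPQ
  set v := (P ∪ Q).card with hvd
  let em := (P ∪ Q).equivFin.symm
  let g : Fin v → Fin n := fun i => (em i).1
  have hginj : Function.Injective g := fun i j hij => em.injective (Subtype.ext hij)
  have hgim : Finset.univ.image g = P ∪ Q := by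
    ext a
    simp only [Finset.mem_image, Finset.mem_univ, true_and]
    constructor
    · rintro ⟨i, rfl⟩; exact (em i).2
    · intro ha; exact ⟨em.symm ⟨a, ha⟩, by simp [g]⟩
  let F := G.comap g
  let L : Finset (Fin v) := Finset.univ.filter fun i => g i ∈ P
  have hL : L.card = P.card := by
    rw [← Finset.card_image_of_injective L hginj]
    congr 1
    ext a
    simp only [L, Finset.mem_image, Finset.mem_filter, Finset.mem_univ, true_and]
    constructor
    · rintro ⟨i, hi, rfl⟩; exact hi
    · intro ha
      have : a ∈ Finset.univ.image g := by rw [hgim]; exact Finset.mem_union_left _ ha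
      obtain ⟨i, _, rfl⟩ := Finset.mem_image.1 this
      exact ⟨i, ha, rfl⟩
  have hE : eN F Finset.univ = eN G (P ∪ Q) := by
    have : IsoOn F G g Finset.univ := ⟨hginj.injOn, fun u _ v _ => Iff.rfl⟩
    rw [← hgim, this.eN_image]
  refine h ⟨⟨v, by omega⟩, F, L⟩ ?_ ⟨g, hginj, ?_, fun i j hij => hij⟩
  · simp only
    rw [hL, hE, hv]
    unfold Phi at hcon
    push_cast
    linarith
  · intro i hi
    exact hP (Finset.mem_filter.1 hi).2

lemma whp_NN {α : ℝ} (hα : 0 < α) (D : ℕ) : Whp α (fun n G => NN α D G) := by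
  refine (whp_N2 (w := 0) (B := fun _ => ∅) hα ?_ D).mono hα
    (Eventually.of_forall fun n G h S hS => ?_)
  · exact Eventually.of_forall fun n => by simp
  · have := h ∅ (by simp) S (by simp) (by simpa using hS)
    simpa [Phi, fR] using this

end RandomGraphSpectra

namespace RandomGraphSpectra

/-- candidate copy -/
def cnd {t N n : ℕ} (V0 : Finset (Fin t)) (g : Fin t → Fin n) (β : Fin t → Fin N → Fin n)
    (h : Fin t → Fin N) : Fin t → Fin n := fun u => if u ∈ V0 then β u (h u) else g u

section Block
variable {t N n : ℕ} {F : SimpleGraph (Fin t)} {W V0 : Finset (Fin t)}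
  {g : Fin t → Fin n} {β : Fin t → Fin N → Fin n}

lemma cnd_eq (hdis : Disjoint W V0) (hg : Set.InjOn g W)
    (hβ : ∀ u i v j, β u i = β v j → u = v ∧ i = j)
    (hgβ : ∀ u i, ∀ v ∈ W, β u i ≠ g v) (h h' : Fin t → Fin N) {a b : Fin t} (ha : a ∈ W ∪ V0)
    (hb : b ∈ W ∪ V0) (hab : cnd V0 g β h a = cnd V0 g β h' b) :
    a = b ∧ (a ∈ W ∨ (a ∈ V0 ∧ h a = h' a)) := by
  unfold cnd at hab
  by_cases h1 : a ∈ V0 <;> by_cases h2 : b ∈ V0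
  · simp only [h1, h2, if_true] at hab
    obtain ⟨rfl, h3⟩ := hβ _ _ _ _ hab
    exact ⟨rfl, Or.inr ⟨h1, h3⟩⟩
  · simp only [h1, h2, if_true, if_false] at hab
    exact absurd hab (hgβ _ _ _ ((Finset.mem_union.1 hb).resolve_right h2))
  · simp only [h1, h2, if_true, if_false] at hab
    exact absurd hab.symm (hgβ _ _ _ ((Finset.mem_union.1 ha).resolve_right h1))
  · simp only [h1, h2, if_false] at hab
    have ha' := (Finset.mem_union.1 ha).resolve_right h1
    exact ⟨hg ha' ((Finset.mem_union.1 hb).resolve_right h2) hab, Or.inl ha'⟩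

lemma cnd_inj (hdis : Disjoint W V0) (hg : Set.InjOn g W)
    (hβ : ∀ u i v j, β u i = β v j → u = v ∧ i = j)
    (hgβ : ∀ u i, ∀ v ∈ W, β u i ≠ g v) (h : Fin t → Fin N) :
    Set.InjOn (cnd V0 g β h) (W ∪ V0 : Finset (Fin t)) :=
  fun _ ha _ hb hab => (cnd_eq hdis hg hβ hgβ h h ha hb hab).1

lemma pat_inter (hdis : Disjoint W V0) (hg : Set.InjOn g W)
    (hβ : ∀ u i v j, β u i = β v j → u = v ∧ i = j)
    (hgβ : ∀ u i, ∀ v ∈ W, β u i ≠ g v) (h h' : Fin t → Fin N) :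
    pat F W (W ∪ V0) (cnd V0 g β h) ∩ pat F W (W ∪ V0) (cnd V0 g β h') ⊆
      pat F W (W ∪ V0.filter fun u => h u = h' u) (cnd V0 g β h) := by
  intro e he
  rw [Finset.mem_inter, mem_pat, mem_pat] at he
  obtain ⟨⟨u, hu, v, hv, huv, hF, h1⟩, ⟨u', hu', v', hv', _, _, h1'⟩⟩ := he
  rw [mem_pat]
  rw [h1, Sym2.eq_iff] at h1'
  have key : ∀ a ∈ W ∪ V0, ∀ b ∈ W ∪ V0, cnd V0 g β h a = cnd V0 g β h' b →
      a ∈ W ∪ V0.filter fun u => h u = h' u := by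
    intro a ha b hb hab
    have := (cnd_eq hdis hg hβ hgβ h h' ha hb hab).2
    rw [Finset.mem_union, Finset.mem_filter]
    exact this
  rcases h1' with ⟨e1, e2⟩ | ⟨e1, e2⟩
  · exact ⟨u, key u hu _ hu' e1, v, key v hv _ hv' e2, huv, hF, h1⟩
  · exact ⟨u, key u hu _ hv' e1, v, key v hv _ hu' e2, huv, hF, h1⟩

lemma sum_agree (hN : 0 < N) (h : Fin t → Fin N) :
    ∑ h' : Fin t → Fin N, (N : ℝ) ^ (Finset.univ.filter fun u => h u = h' u).card ≤ (2 * N) ^ t := by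
  have e1 : ∀ h' : Fin t → Fin N, (N : ℝ) ^ (Finset.univ.filter fun u => h u = h' u).card =
      ∏ u, (if h u = h' u then (N : ℝ) else 1) := by
    intro h'
    rw [Finset.prod_ite, Finset.prod_const, Finset.prod_const_one, mul_one]
  have e2 := Finset.prod_univ_sum (fun _ : Fin t => (Finset.univ : Finset (Fin N)))
    (fun u b => if h u = b then (N : ℝ) else 1)
  simp only [Fintype.piFinset_univ] at e2
  simp only [e1]
  rw [← e2]
  calc _ ≤ ∏ _u : Fin t, (2 * N : ℝ) := by
        refine Finset.prod_le_prod (fun u _ => Finset.sum_nonneg fun b _ => by split_ifs <;> positivity)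
          fun u _ => ?_
        calc _ ≤ ∑ b : Fin N, ((if h u = b then (N:ℝ) else 0) + 1) := by
              refine Finset.sum_le_sum fun b _ => ?_
              split_ifs <;> simp
          _ = 2 * N := by
              rw [Finset.sum_add_distrib]; simp; ring
    _ = _ := by simp

lemma ind_mul {E : Type*} [DecidableEq E] (S T : Finset E) (ω : E → Bool) :
    (if ∀ e ∈ S, ω e = true then (1:ℝ) else 0) * (if ∀ e ∈ T, ω e = true then (1:ℝ) else 0) =
      if ∀ e ∈ S ∪ T, ω e = true then (1:ℝ) else 0 := by
  have h : (∀ e ∈ S ∪ T, ω e = true) ↔ (∀ e ∈ S, ω e = true) ∧ (∀ e ∈ T, ω e = true) := by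
    simp only [Finset.mem_union, or_imp, forall_and]
  by_cases h1 : ∀ e ∈ S, ω e = true
  · by_cases h2 : ∀ e ∈ T, ω e = true
    · rw [if_pos h1, if_pos h2, if_pos (h.2 ⟨h1, h2⟩), one_mul]
    · have h3 : ¬ ∀ e ∈ S ∪ T, ω e = true := fun hh => h2 (h.1 hh).2
      rw [if_neg h2, if_neg h3, mul_zero]
  · have h3 : ¬ ∀ e ∈ S ∪ T, ω e = true := fun hh => h1 (h.1 hh).1
    rw [if_neg h1, if_neg h3, zero_mul]

set_option maxHeartbeats 1600000 in
lemma block {p : ℝ} (hp0 : 0 < p) (hp1 : p ≤ 1) (hN : 0 < N) (hdis : Disjoint W V0)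
    (hg : Set.InjOn g W) (hβ : ∀ u i v j, β u i = β v j → u = v ∧ i = j)
    (hgβ : ∀ u i, ∀ v ∈ W, β u i ≠ g v)
    (hS : ∀ S ⊆ V0, (1:ℝ) ≤ (N : ℝ) ^ S.card * p ^ (eN F (W ∪ S) - eN F W)) :
    Pr p (fun ω : PE n → Bool => ∀ h : Fin t → Fin N,
      ¬ ∀ e ∈ pat F W (W ∪ V0) (cnd V0 g β h), ω e = true) ≤ 1 - (1 / 2) ^ t := by
  set e0 := eN F (W ∪ V0) - eN F W with he0
  let T : (Fin t → Fin N) → Finset (PE n) := fun h => pat F W (W ∪ V0) (cnd V0 g β h)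
  have hTc : ∀ h, (T h).card = e0 := by
    intro h
    have := card_pat F Finset.subset_union_left (cnd_inj hdis hg hβ hgβ h)
    simp only [T]; omega
  let X : (Fin t → Fin N) → (PE n → Bool) → ℝ := fun h ω => if ∀ e ∈ T h, ω e = true then 1 else 0
  let Z : (PE n → Bool) → ℝ := fun ω => ∑ h, X h ω
  have hNr : (0:ℝ) < N := by exact_mod_cast hN
  set μ : ℝ := N ^ t * p ^ e0 with hμ
  have hμpos : 0 < μ := by positivity
  have hEZ : Ex p Z = μ := by
    simp only [Z]
    rw [Ex_sum]
    simp only [X, Ex_edges, hTc]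
    simp [hμ]
  have hXX : ∀ h h', Ex p (fun ω => X h ω * X h' ω) ≤
      N ^ (Finset.univ.filter fun u => h u = h' u).card * p ^ (2 * e0) := by
    intro h h'
    have e1 : (fun ω => X h ω * X h' ω) = fun ω => if ∀ e ∈ T h ∪ T h', ω e = true then 1 else 0 := by
      funext ω
      simp only [X]
      convert ind_mul (T h) (T h') ω
    rw [e1, Ex_edges]
    set S := V0.filter fun u => h u = h' u with hSd
    have hSV : S ⊆ V0 := Finset.filter_subset _ _
    have c1 := Finset.card_union_add_card_inter (T h) (T h')
    have c2 := Finset.card_le_card (pat_inter (F := F) hdis hg hβ hgβ h h')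
    rw [← hSd] at c2
    have c3 := card_pat F (Finset.subset_union_left : W ⊆ W ∪ S)
      ((cnd_inj hdis hg hβ hgβ h).mono (by
        exact_mod_cast Finset.union_subset_union_right hSV))
    rw [hTc, hTc] at c1
    set es := eN F (W ∪ S) - eN F W with hes
    have c4 : 2 * e0 ≤ (T h ∪ T h').card + es := by
      simp only [T] at c1 ⊢
      omega
    have hle : es ≤ e0 := by
      have := eN_mono (G := F) (Finset.union_subset_union_right hSV : W ∪ S ⊆ W ∪ V0)
      omega
    have hN1 : (1:ℝ) ≤ N := by exact_mod_cast hN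
    have hSc : S.card ≤ (Finset.univ.filter fun u => h u = h' u).card :=
      Finset.card_le_card (by
        intro a ha
        exact Finset.mem_filter.2 ⟨Finset.mem_univ _, (Finset.mem_filter.1 ha).2⟩)
    calc p ^ (T h ∪ T h').card ≤ p ^ (2 * e0 - es) := pow_le_pow_of_le_one hp0.le hp1 (by omega)
      _ ≤ p ^ (2 * e0 - es) * (N ^ S.card * p ^ es) := le_mul_of_one_le_right (by positivity) (hS S hSV)
      _ = N ^ S.card * p ^ (2 * e0) := by
          rw [show 2 * e0 = (2 * e0 - es) + es by omega, pow_add]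
          simp only [Nat.add_sub_cancel]
          ring
      _ ≤ _ := by gcongr
  have hEZ2 : Ex p (fun ω => Z ω * Z ω) ≤ 2 ^ t * μ ^ 2 := by
    have e1 : (fun ω => Z ω * Z ω) = fun ω => ∑ h, ∑ h', X h ω * X h' ω := by
      funext ω
      simp only [Z, Finset.sum_mul_sum]
    rw [e1, Ex_sum]
    calc _ = ∑ h, ∑ h', Ex p (fun ω => X h ω * X h' ω) :=
          Finset.sum_congr rfl fun h _ => Ex_sum _ _ _
      _ ≤ ∑ h : Fin t → Fin N, ∑ h' : Fin t → Fin N,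
            (N:ℝ) ^ (Finset.univ.filter fun u => h u = h' u).card * p ^ (2 * e0) :=
          Finset.sum_le_sum fun h _ => Finset.sum_le_sum fun h' _ => hXX h h'
      _ ≤ ∑ h : Fin t → Fin N, (2 * (N:ℝ)) ^ t * p ^ (2 * e0) := by
          refine Finset.sum_le_sum fun h _ => ?_
          rw [← Finset.sum_mul]
          exact mul_le_mul_of_nonneg_right (sum_agree hN h) (by positivity)
      _ = 2 ^ t * μ ^ 2 := by
          simp only [Finset.sum_const, Finset.card_univ, nsmul_eq_mul, Fintype.card_pi,
            Fintype.card_fin, Finset.prod_const, hμ]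
          push_cast
          ring
  set lam : ℝ := 2 ^ t * μ with hlam
  have hlpos : 0 < lam := by positivity
  have hpt : ∀ ω, (1 / lam ^ 2) * (2 * lam * Z ω - Z ω * Z ω) ≤
      if ¬ (∀ h : Fin t → Fin N, ¬ ∀ e ∈ T h, ω e = true) then (1:ℝ) else 0 := by
    intro ω
    by_cases hh : ∀ h : Fin t → Fin N, ¬ ∀ e ∈ T h, ω e = true
    · have : Z ω = 0 := Finset.sum_eq_zero fun h _ => if_neg (hh h)
      rw [if_neg (not_not.2 hh), this]; simp
    · rw [if_pos hh, one_div, inv_mul_le_iff₀ (by positivity)]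
      nlinarith [sq_nonneg (Z ω - lam)]
  have hmono := Ex_mono hp0.le hp1 hpt
  have hc := Pr_compl p (fun ω : PE n → Bool => ∀ h : Fin t → Fin N, ¬ ∀ e ∈ T h, ω e = true)
  have hpr : Ex p (fun ω : PE n → Bool =>
      if ¬ (∀ h : Fin t → Fin N, ¬ ∀ e ∈ T h, ω e = true) then (1:ℝ) else 0) =
      Pr p (fun ω : PE n → Bool => ¬ ∀ h : Fin t → Fin N, ¬ ∀ e ∈ T h, ω e = true) := by
    unfold Pr
    congr 1
    funext ω
    by_cases hh : ∀ h : Fin t → Fin N, ¬ ∀ e ∈ T h, ω e = true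
    · rw [if_neg (not_not.2 hh), if_neg (not_not.2 hh)]
    · rw [if_pos hh, if_pos hh]
  rw [hpr, hc, Ex_const_mul, Ex_sub, Ex_const_mul, hEZ] at hmono
  have hfin : ((1:ℝ) / 2) ^ t ≤ 1 / lam ^ 2 * (2 * lam * μ - Ex p (fun ω => Z ω * Z ω)) := by
    have h2 : (0:ℝ) < 2 ^ t := by positivity
    calc ((1:ℝ) / 2) ^ t = 1 / lam ^ 2 * (2 * lam * μ - 2 ^ t * μ ^ 2) := by
          rw [hlam, one_div, inv_pow]
          field_simp
          ring
      _ ≤ _ := by gcongr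
  linarith

end Block

section Multi
variable {t N M n : ℕ} {F : SimpleGraph (Fin t)} {W V0 : Finset (Fin t)} 

lemma multi {p : ℝ} (hp0 : 0 < p) (hp1 : p ≤ 1) (hN : 0 < N) (hdis : Disjoint W V0)
    {g : Fin t → Fin n} (ι : Fin M × Fin t × Fin N ↪ Fin n)
    (hg : Set.InjOn g W) (J : Finset (Fin M))
    (hgβ : ∀ j ∈ J, ∀ u i, ∀ v ∈ W, ι (j, u, i) ≠ g v)
    (hS : ∀ S ⊆ V0, (1:ℝ) ≤ (N : ℝ) ^ S.card * p ^ (eN F (W ∪ S) - eN F W)) :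
    Pr p (fun ω : PE n → Bool => ∀ j ∈ J, ∀ h : Fin t → Fin N,
      ¬ ∀ e ∈ pat F W (W ∪ V0) (cnd V0 g (fun u i => ι (j, u, i)) h), ω e = true) ≤
      (1 - (1 / 2) ^ t) ^ J.card := by
  let Sj : Fin M → Set (PE n) := fun j => {e | (∃ a ∈ e.1, ∃ u i, a = ι (j, u, i)) ∧
    ∀ a ∈ e.1, (∃ u i, a = ι (j, u, i)) ∨ ∃ v ∈ W, a = g v}
  have hsub : ∀ j h, ∀ e ∈ pat F W (W ∪ V0) (cnd V0 g (fun u i => ι (j, u, i)) h), e ∈ Sj j := by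
    intro j h e he
    rw [mem_pat] at he
    obtain ⟨u, hu, v, hv, huv, _, h1⟩ := he
    have key : ∀ x ∈ W ∪ V0, (∃ u i, cnd V0 g (fun u i => ι (j, u, i)) h x = ι (j, u, i)) ∨
        ∃ v ∈ W, cnd V0 g (fun u i => ι (j, u, i)) h x = g v := by
      intro x hx
      unfold cnd
      by_cases hx0 : x ∈ V0
      · left; exact ⟨x, h x, by simp [hx0]⟩
      · right; exact ⟨x, (Finset.mem_union.1 hx).resolve_right hx0, by simp [hx0]⟩
    have key2 : ∀ x ∈ V0, ∃ u i, cnd V0 g (fun u i => ι (j, u, i)) h x = ι (j, u, i) := by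
      intro x hx0
      exact ⟨x, h x, by simp [cnd, hx0]⟩
    refine ⟨?_, ?_⟩
    · rw [h1]
      by_cases huW : u ∈ W
      · have : v ∈ V0 := (Finset.mem_union.1 hv).resolve_left fun h => huv ⟨huW, h⟩
        exact ⟨_, by simp, key2 v this⟩
      · have : u ∈ V0 := (Finset.mem_union.1 hu).resolve_left huW
        exact ⟨_, by simp, key2 u this⟩
    · rw [h1]
      intro a ha
      rw [Sym2.mem_iff] at ha
      rcases ha with rfl | rfl
      · exact key u hu
      · exact key v hv
  rw [Pr_indep_all p J Sj]
  · rw [← Finset.prod_const]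
    refine Finset.prod_le_prod (fun j _ => Pr_nonneg hp0.le hp1 _) fun j hj => ?_
    refine block hp0 hp1 hN hdis hg ?_ (hgβ j hj) hS
    intro u i v k h
    have := ι.injective h
    simpa using this
  · intro i hi j hj hij
    rw [Set.disjoint_left]
    rintro e ⟨⟨a, ha, u, k, hak⟩, _⟩ ⟨_, he⟩
    rcases he a ha with ⟨u', k', h⟩ | ⟨v, hv, h⟩
    · rw [hak] at h
      have := ι.injective h
      simp only [Prod.mk.injEq] at this
      exact hij this.1
    · rw [hak] at h
      exact hgβ i hi _ _ _ hv h
  · intro j _ ω ω' h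
    refine propext (forall_congr' fun hh => not_congr (forall₂_congr fun e he => ?_))
    rw [h e (hsub j hh e he)]

lemma AA_bound {p : ℝ} (hp0 : 0 < p) (hp1 : p ≤ 1) (hN : 0 < N) (hn : 0 < n) (hdis : Disjoint W V0)
    (ι : Fin M × Fin t × Fin N ↪ Fin n) (Dy : ℕ)
    (hS : ∀ S ⊆ V0, (1:ℝ) ≤ (N : ℝ) ^ S.card * p ^ (eN F (W ∪ S) - eN F W)) :
    Pr p (fun ω : PE n → Bool => ¬ AA (gr ω) F W V0 (Finset.univ.map ι) Dy) ≤
      (n : ℝ) ^ (t + (Dy + 1)) * (1 - (1 / 2) ^ t) ^ (M - (Dy + 1)) := by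
  classical
  let Jf : (Fin (Dy + 1) → Fin n) → Finset (Fin M) := fun y =>
    Finset.univ.filter fun j => ∀ u i, ι (j, u, i) ∉ Finset.univ.image y
  have hJ : ∀ y, M - (Dy + 1) ≤ (Jf y).card := by
    intro y
    have h1 := Finset.card_filter_add_card_filter_not (s := (Finset.univ : Finset (Fin M)))
      (p := fun j => ∀ u i, ι (j, u, i) ∉ Finset.univ.image y)
    have h2 : (Finset.univ.filter fun j : Fin M => ¬ ∀ u i, ι (j, u, i) ∉ Finset.univ.image y).card
        ≤ Dy + 1 := by
      have : ∀ j ∈ (Finset.univ.filter fun j : Fin M => ¬ ∀ u i, ι (j, u, i) ∉ Finset.univ.image y),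
          ∃ k : Fin (Dy + 1), ∃ u i, ι (j, u, i) = y k := by
        intro j hj
        have := (Finset.mem_filter.1 hj).2
        push Not at this
        obtain ⟨u, i, h⟩ := this
        obtain ⟨k, _, h⟩ := Finset.mem_image.1 h
        exact ⟨k, u, i, h.symm⟩
      choose! f hf using this
      have := Finset.card_le_card_of_injOn (t := Finset.univ) f (fun _ _ => Finset.mem_univ _) (by
        intro a ha b hb hab
        obtain ⟨u, i, h⟩ := hf a ha
        obtain ⟨u', i', h'⟩ := hf b hb
        rw [hab, ← h'] at h
        have := ι.injective h
        simp only [Prod.mk.injEq] at this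
        exact this.1)
      simpa using this
    simp only [Finset.card_univ, Fintype.card_fin] at h1
    simp only [Jf]
    omega
  let I : Finset ((Fin t → Fin n) × (Fin (Dy + 1) → Fin n)) := Finset.univ.filter fun x =>
    Set.InjOn x.1 W ∧ W.image x.1 ⊆ Finset.univ.image x.2
  have hc0 : (0:ℝ) ≤ 1 - (1 / 2) ^ t := by
    have : ((1:ℝ) / 2) ^ t ≤ 1 := pow_le_one₀ (by norm_num) (by norm_num)
    linarith
  have hc1 : (1 - (1 / 2) ^ t : ℝ) ≤ 1 := by
    have : (0:ℝ) ≤ (1 / 2) ^ t := by positivity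
    linarith
  calc _ ≤ Pr p (fun ω : PE n → Bool => ∃ x ∈ I, ∀ j ∈ Jf x.2, ∀ h : Fin t → Fin N,
      ¬ ∀ e ∈ pat F W (W ∪ V0) (cnd V0 x.1 (fun u i => ι (j, u, i)) h), ω e = true) := by
        refine Pr_mono hp0.le hp1 fun ω hAA => ?_
        unfold AA at hAA
        push Not at hAA
        obtain ⟨g, hg, Y, hY, hWY, hno⟩ := hAA
        let y : Fin (Dy + 1) → Fin n := fun i =>
          if h : (i : ℕ) < Y.card then (Y.equivFin.symm ⟨i, h⟩).1 else ⟨0, hn⟩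
        have hyY : Y ⊆ Finset.univ.image y := by
          intro a ha
          refine Finset.mem_image.2 ⟨⟨(Y.equivFin ⟨a, ha⟩ : ℕ), ?_⟩, Finset.mem_univ _, ?_⟩
          · have := (Y.equivFin ⟨a, ha⟩).2; omega
          · simp [y]
        refine ⟨(g, y), Finset.mem_filter.2 ⟨Finset.mem_univ _, hg, hWY.trans hyY⟩, ?_⟩
        intro j hj h hpat
        have hj' := (Finset.mem_filter.1 hj).2
        have hβ : ∀ u i v k, ι (j, u, i) = ι (j, v, k) → u = v ∧ i = k := by
          intro u i v k h
          have := ι.injective h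
          simpa using this
        have hgβ : ∀ u i, ∀ v ∈ W, ι (j, u, i) ≠ g v := by
          intro u i v hv h
          apply hj' u i
          rw [h]
          exact hyY (hWY (Finset.mem_image_of_mem _ hv))
        have hinj := cnd_inj hdis hg hβ hgβ h
        rw [pat_iff F hinj] at hpat
        obtain ⟨u, hu, v, hv, huv, hF, hG⟩ := hno _ hinj (by
          intro u hu
          have : u ∉ V0 := Finset.disjoint_left.1 hdis hu
          simp [cnd, this]) (by
          intro u hu
          simp only [cnd, hu, if_true]
          exact ⟨Finset.mem_map_of_mem _ (Finset.mem_univ _), fun h => hj' _ _ (hyY h)⟩)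
        exact hG (hpat u hu v hv (by tauto) hF)
    _ ≤ ∑ x ∈ I, Pr p (fun ω : PE n → Bool => ∀ j ∈ Jf x.2, ∀ h : Fin t → Fin N,
      ¬ ∀ e ∈ pat F W (W ∪ V0) (cnd V0 x.1 (fun u i => ι (j, u, i)) h), ω e = true) :=
        Pr_union hp0.le hp1 _ _
    _ ≤ ∑ x ∈ I, (1 - (1 / 2) ^ t : ℝ) ^ (M - (Dy + 1)) := by
        refine Finset.sum_le_sum fun x hx => ?_
        have hx' := (Finset.mem_filter.1 hx).2
        refine (multi hp0 hp1 hN hdis ι hx'.1 (Jf x.2) ?_ hS).trans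
          (pow_le_pow_of_le_one hc0 hc1 (hJ _))
        intro j hj u i v hv h
        apply (Finset.mem_filter.1 hj).2 u i
        rw [h]
        exact hx'.2 (Finset.mem_image_of_mem _ hv)
    _ ≤ _ := by
        rw [Finset.sum_const, nsmul_eq_mul]
        gcongr
        have : I.card ≤ n ^ (t + (Dy + 1)) := by
          refine (Finset.card_le_univ I).trans ?_
          simp [Fintype.card_prod, pow_add]
        exact_mod_cast this

end Multi
end RandomGraphSpectra

namespace RandomGraphSpectra

lemma decay {η s : ℝ} (hη : 0 < η) (hs0 : 0 < s) (hs1 : s ≤ 1) (K K' : ℕ) :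
    Tendsto (fun n : ℕ => (n : ℝ) ^ K * (1 - s) ^ (⌊(n : ℝ) ^ η⌋₊ - K')) atTop (𝓝 0) := by
  have h1 : Tendsto (fun n : ℕ => (n : ℝ) ^ η) atTop atTop :=
    (tendsto_rpow_atTop hη).comp tendsto_natCast_atTop_atTop
  have h2 := ((tendsto_rpow_mul_exp_neg_mul_atTop_nhds_zero (K / η) s hs0).comp h1).const_mul
    (Real.exp (s * (K' + 1)))
  rw [mul_zero] at h2
  refine tendsto_of_tendsto_of_tendsto_of_le_of_le' tendsto_const_nhds h2
    (Eventually.of_forall fun n => ?_) ?_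
  · have : 0 ≤ 1 - s := by linarith
    positivity
  · filter_upwards [eventually_ge_atTop 1] with n hn
    have hn0 : (0:ℝ) < n := by exact_mod_cast hn
    simp only [Function.comp]
    have e1 : ((n : ℝ) ^ η) ^ (K / η) = (n:ℝ) ^ K := by
      rw [← Real.rpow_mul hn0.le, mul_div_cancel₀ _ hη.ne', Real.rpow_natCast]
    rw [e1]
    set m := ⌊(n : ℝ) ^ η⌋₊ - K' with hm
    have e2 : (n : ℝ) ^ η - (K' + 1) ≤ m := by
      have a1 := Nat.lt_floor_add_one ((n : ℝ) ^ η)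
      have a2 : (⌊(n : ℝ) ^ η⌋₊ : ℝ) ≤ m + K' := by
        exact_mod_cast (by omega : ⌊(n : ℝ) ^ η⌋₊ ≤ m + K')
      linarith
    have e3 : (1 - s) ^ m ≤ Real.exp (-s * m) := by
      have := Real.one_sub_le_exp_neg s
      calc (1 - s) ^ m ≤ (Real.exp (-s)) ^ m := pow_le_pow_left₀ (by linarith) this m
        _ = _ := by rw [← Real.exp_nat_mul]; congr 1; ring
    have e4 : Real.exp (-s * m) ≤ Real.exp (s * (K' + 1)) * Real.exp (-s * (n : ℝ) ^ η) := by
      rw [← Real.exp_add, Real.exp_le_exp]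
      nlinarith
    calc (n : ℝ) ^ K * (1 - s) ^ m ≤ (n : ℝ) ^ K *
          (Real.exp (s * (K' + 1)) * Real.exp (-s * (n : ℝ) ^ η)) := by
            gcongr
            exact e3.trans e4
      _ = _ := by ring

lemma whp_AA {α w η : ℝ} (hα : 0 < α) (hw0 : 0 ≤ w) (hη : 0 < η) (hwη : w + η ≤ 1) {t : ℕ}
    {F : SimpleGraph (Fin t)} {W V0 : Finset (Fin t)} (hdis : Disjoint W V0)
    (hS : ∀ S ⊆ V0, α * (eN F (W ∪ S) - eN F W) ≤ w * S.card) (Dy : ℕ) :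
    ∃ B : ∀ n, Finset (Fin n), (∀ᶠ n : ℕ in atTop, ((B n).card : ℝ) ≤ (n : ℝ) ^ (w + η)) ∧
      Whp α (fun n G => AA G F W V0 (B n) Dy) := by
  classical
  let M : ℕ → ℕ := fun n => ⌊(n : ℝ) ^ (η / 2)⌋₊
  let N : ℕ → ℕ := fun n => ⌈(n : ℝ) ^ w⌉₊
  let B : ∀ n, Finset (Fin n) := fun n =>
    if h : Nonempty (Fin (M n) × Fin t × Fin (N n) ↪ Fin n) then Finset.univ.map h.some else ∅
  have hlarge : ∀ᶠ n : ℕ in atTop, (2 * t : ℝ) ≤ (n : ℝ) ^ (η / 2) :=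
    ((tendsto_rpow_atTop (by linarith : 0 < η / 2)).comp
      tendsto_natCast_atTop_atTop).eventually_ge_atTop _
  have hsize : ∀ᶠ n : ℕ in atTop, ((M n * (t * N n) : ℕ) : ℝ) ≤ (n : ℝ) ^ (w + η) := by
    filter_upwards [hlarge, eventually_ge_atTop 1] with n h1 hn
    have hn1 : (1:ℝ) ≤ n := by exact_mod_cast hn
    have hn0 : (0:ℝ) < n := by linarith
    have hM : (M n : ℝ) ≤ (n : ℝ) ^ (η / 2) := Nat.floor_le (by positivity)
    have hw1 : 1 ≤ (n : ℝ) ^ w := Real.one_le_rpow hn1 hw0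
    have hN : (N n : ℝ) ≤ 2 * (n : ℝ) ^ w := by
      have := Nat.ceil_lt_add_one (by positivity : 0 ≤ (n : ℝ) ^ w)
      simp only [N]; linarith
    push_cast
    calc (M n : ℝ) * (t * N n) ≤ (n : ℝ) ^ (η / 2) * (t * (2 * (n : ℝ) ^ w)) := by gcongr
      _ = (2 * t) * ((n : ℝ) ^ (η / 2) * (n : ℝ) ^ w) := by ring
      _ ≤ (n : ℝ) ^ (η / 2) * ((n : ℝ) ^ (η / 2) * (n : ℝ) ^ w) := by gcongr
      _ = (n : ℝ) ^ (w + η) := by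
        rw [← Real.rpow_add hn0, ← Real.rpow_add hn0]; congr 1; ring
  have hemb : ∀ᶠ n : ℕ in atTop, Nonempty (Fin (M n) × Fin t × Fin (N n) ↪ Fin n) := by
    filter_upwards [hsize, eventually_ge_atTop 1] with n h1 hn
    have hn1 : (1:ℝ) ≤ n := by exact_mod_cast hn
    rw [Function.Embedding.nonempty_iff_card_le]
    simp only [Fintype.card_prod, Fintype.card_fin]
    have h2 : (n : ℝ) ^ (w + η) ≤ n := by
      calc (n : ℝ) ^ (w + η) ≤ (n : ℝ) ^ (1:ℝ) := Real.rpow_le_rpow_of_exponent_le hn1 hwη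
        _ = n := Real.rpow_one _
    exact_mod_cast h1.trans h2
  refine ⟨B, ?_, ?_⟩
  · filter_upwards [hsize, hemb] with n h1 h2
    have : (B n).card = M n * (t * N n) := by
      simp [B, h2, Fintype.card_prod]
    rw [this]; exact h1
  · have hs0 : (0:ℝ) < (1 / 2) ^ t := by positivity
    have hs1 : ((1:ℝ) / 2) ^ t ≤ 1 := pow_le_one₀ (by norm_num) (by norm_num)
    refine whp_of_bound hα (decay (η := η / 2) (by linarith) hs0 hs1 (t + (Dy + 1)) (Dy + 1)) ?_
    filter_upwards [hemb, eventually_ge_atTop 1] with n h2 hn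
    have hn1 : (1:ℝ) ≤ n := by exact_mod_cast hn
    have hn0 : (0:ℝ) < n := by linarith
    have hB : B n = Finset.univ.map h2.some := by simp [B, h2]
    rw [hB]
    have hw1 : 1 ≤ (n : ℝ) ^ w := Real.one_le_rpow hn1 hw0
    have hNle : (n : ℝ) ^ w ≤ N n := Nat.le_ceil _
    have hN : 0 < N n := by
      have : (0:ℝ) < N n := by linarith
      exact_mod_cast this
    refine AA_bound (by positivity) (pn_le_one hα n) hN hn hdis h2.some Dy ?_
    intro S hSV
    have hm := eN_mono (G := F) (Finset.subset_union_left : W ⊆ W ∪ S)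
    have h3 := hS S hSV
    rw [← Nat.cast_sub hm] at h3
    calc (1:ℝ) ≤ (n : ℝ) ^ (w * S.card + -α * (eN F (W ∪ S) - eN F W : ℕ)) :=
          Real.one_le_rpow hn1 (by linarith)
      _ = ((n : ℝ) ^ w) ^ S.card * ((n : ℝ) ^ (-α)) ^ (eN F (W ∪ S) - eN F W) := by
          rw [Real.rpow_add hn0, Real.rpow_mul hn0.le, Real.rpow_mul hn0.le, Real.rpow_natCast,
            Real.rpow_natCast]
      _ ≤ _ := by gcongr

lemma exists_delta {α : ℝ} (hα : 0 < α) (D : ℕ) :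
    ∃ δ : ℝ, 0 < δ ∧ ∀ a ≤ D, ∀ b : ℕ, (a : ℝ) - α * b < 0 → (a : ℝ) - α * b ≤ -δ := by
  have h1 : ∀ a : ℕ, ∃ δ : ℝ, 0 < δ ∧ ∀ b : ℕ, (a : ℝ) - α * b < 0 → (a : ℝ) - α * b ≤ -δ := by
    intro a
    set b0 := ⌊(a : ℝ) / α⌋₊ + 1 with hb0
    have hb1 : (a : ℝ) / α < b0 := by
      rw [hb0]; push_cast; exact Nat.lt_floor_add_one _
    rw [div_lt_iff₀ hα] at hb1
    refine ⟨α * b0 - a, by linarith, fun b hb => ?_⟩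
    have h2 : b0 ≤ b := by
      rw [hb0, Nat.succ_le_iff, Nat.floor_lt (by positivity), div_lt_iff₀ hα]
      linarith
    have h3 : (b0 : ℝ) ≤ b := by exact_mod_cast h2
    nlinarith
  choose d hd0 hd using h1
  obtain ⟨a0, _, ha0⟩ := Finset.exists_min_image (Finset.range (D + 1)) d ⟨0, by simp⟩
  refine ⟨d a0, hd0 a0, fun a ha b hb => ?_⟩
  have := ha0 a (by simp; omega)
  have := hd a b hb
  linarith

lemma whp_ExtG {α : ℝ} (hα : 0 < α) (D : ℕ) {t : ℕ} (F : SimpleGraph (Fin t)) :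
    ∀ (m : ℕ) (W U : Finset (Fin t)), (U \ W).card ≤ m → W ⊆ U → Safe α F W U →
      Whp α (fun n G => ExtG α D G F W U) := by
  intro m
  induction m with
  | zero =>
    intro W U hm hWU _
    have : W = U := by
      apply Finset.Subset.antisymm hWU
      rw [Nat.le_zero, Finset.card_eq_zero, Finset.sdiff_eq_empty_iff_subset] at hm
      exact hm
    subst this
    exact whp_true hα fun n G => extG_refl α D G F W
  | succ m ih =>
    intro W U hm hWU hs
    by_cases hne : W = U
    · subst hne
      exact whp_true hα fun n G => extG_refl α D G F W
    obtain ⟨V0, w, hV0, hVU, hdis, hw0, hw1, hw, hS, hs2⟩ := exists_V0 hα F hWU hne hs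
    have h2 := ih (W ∪ V0) U (by
      have h1 : U \ (W ∪ V0) ⊂ U \ W := by
        obtain ⟨a, ha⟩ := hV0
        refine Finset.ssubset_iff_subset_ne.2 ⟨Finset.sdiff_subset_sdiff subset_rfl
          Finset.subset_union_left, fun h => ?_⟩
        have h3 : a ∈ U \ W := Finset.mem_sdiff.2 ⟨hVU ha, Finset.disjoint_right.1 hdis ha⟩
        rw [← h] at h3
        exact (Finset.mem_sdiff.1 h3).2 (Finset.mem_union_right _ ha)
      have := Finset.card_lt_card h1
      omega) (Finset.union_subset hWU hVU) hs2
    obtain ⟨δ, hδ0, hδ⟩ := exists_delta hα D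
    set η : ℝ := min (1 - w) (δ / 2 / (t + 1)) with hη
    have hη0 : 0 < η := lt_min (by linarith) (by positivity)
    have hη1 : w + η ≤ 1 := by have := min_le_left (1 - w) (δ / 2 / (t + 1)); linarith
    have hη2 : t * η ≤ δ / 2 := by
      have h3 : η ≤ δ / 2 / (t + 1) := min_le_right _ _
      rw [le_div_iff₀ (by positivity)] at h3
      nlinarith
    obtain ⟨L, hL⟩ := exists_nat_gt ((t : ℝ) / (δ / 2))
    rw [div_lt_iff₀ (by positivity)] at hL
    obtain ⟨B, hB, hAA⟩ := whp_AA hα hw0 hη0 hη1 hdis hS (t + L * (t + D))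
    have hN := whp_N2 hα hB (t + L * (t + D))
    refine ((hAA.and hα hN).and hα h2).mono hα (Eventually.of_forall fun n G h => ?_)
    exact extG_trans Finset.subset_union_left (Finset.union_subset hWU hVU)
      (ext_step hα hδ hη0.le hη2 hL hdis hw h.1.1 h.1.2) h.2

lemma whp_Good {α : ℝ} (hα : 0 < α) (D : ℕ) : Whp α (fun n G => Good α D G) := by
  classical
  have key : Whp α (fun n G =>
      ∀ x : (Σ v : Fin (D + 1), SimpleGraph (Fin v) × Finset (Fin v)),
      Safe α x.2.1 x.2.2 Finset.univ → ExtG α D G x.2.1 x.2.2 Finset.univ) := by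
    refine Whp.fintype hα fun x => ?_
    by_cases hx : Safe α x.2.1 x.2.2 Finset.univ
    · exact (whp_ExtG hα D x.2.1 _ _ _ le_rfl (Finset.subset_univ _) hx).mono hα
        (Eventually.of_forall fun n G h _ => h)
    · exact whp_true hα fun n G h => absurd h hx
  refine ((whp_NN hα D).and hα key).mono hα (Eventually.of_forall fun n G h => ⟨h.1, ?_⟩)
  intro t ht F W hs
  exact h.2 ⟨⟨t, by omega⟩, F, W⟩ hs

lemma zero_one {k m D : ℕ} {α : ℝ} (hk : k = m + 2) (hα0 : 0 < α) (hα1 : α < 1)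
    (hα : ((2 ^ m - 1 : ℕ) + 1) * (1 - α) ≤ (1:ℝ) / 2)
    (hne : NonExc α D) (hD1 : cb (2 ^ m - 1) 2 + 2 ^ m ≤ D)
    (hD2 : cb (2 ^ m - 1) (cb (2 ^ m - 1) (w0 (cb (2 ^ m - 1) 2)) + 1) + 2 ^ m ≤ D)
    (hD3 : cb (2 ^ m - 1) 1 + cb (2 ^ m - 1) (m + 2) ≤ D)
    (φ : FirstOrder.Language.graph.Sentence) (hφ : qDepth φ ≤ k) :
    Tendsto (fun n : ℕ => probSat n ((n : ℝ) ^ (-α)) φ) atTop (nhds 0) ∨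
      Tendsto (fun n : ℕ => probSat n ((n : ℝ) ^ (-α)) φ) atTop (nhds 1) := by
  have hgood := whp_Good hα0 D
  have heq : ∀ n, probSat n ((n : ℝ) ^ (-α)) φ =
      Pr ((n : ℝ) ^ (-α)) (fun ω : PE n → Bool => GraphSat (gr ω) φ) := fun n => probPred_eq _ _ _
  simp only [heq]
  by_cases hex : ∃ n : ℕ, 0 < n ∧ ∃ G : SimpleGraph (Fin n), Good α D G ∧ GraphSat G φ
  · right
    obtain ⟨n0, hn0, G0, hG0, hs0⟩ := hex
    have : Whp α (fun n G => GraphSat G φ) := by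
      refine hgood.mono hα0 ?_
      filter_upwards [eventually_ge_atTop 1] with n hn G hG
      have : Nonempty (Fin n) := ⟨⟨0, hn⟩⟩
      have : Nonempty (Fin n0) := ⟨⟨0, hn0⟩⟩
      exact (EqI.graphSat (fun x y => good_eqI hα hα1 hne hG0 hG hD1 hD2 hD3 x y) φ
        (hφ.trans hk.le)).1 hs0
    have h2 := this.const_sub 1
    simp only [sub_zero] at h2
    refine h2.congr fun n => ?_
    rw [Pr_compl]; ring
  · left
    have : Whp α (fun n G => ¬ GraphSat G φ) := by
      refine hgood.mono hα0 ?_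
      filter_upwards [eventually_ge_atTop 1] with n hn G hG hs
      exact hex ⟨n, hn, G, hG, hs⟩
    unfold Whp at this
    simpa only [not_not] using this

lemma main_finite (k : ℕ) (hk : 3 < k) :
    (S1 k ∩ Set.Ioo (1 - 1 / (2 : ℝ) ^ (k - 1)) 1).Finite := by
  obtain ⟨m, rfl⟩ : ∃ m, k = m + 2 := ⟨k - 2, by omega⟩
  set D := (cb (2 ^ m - 1) 2 + 2 ^ m) +
    (cb (2 ^ m - 1) (cb (2 ^ m - 1) (w0 (cb (2 ^ m - 1) 2)) + 1) + 2 ^ m) +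
    (cb (2 ^ m - 1) 1 + cb (2 ^ m - 1) (m + 2)) with hD
  have hfin : (Set.range fun x : Fin (D + 1) × Fin ((D + 1) ^ 2 + 1) =>
      ((x.1 : ℕ) : ℝ) / ((x.2 : ℕ) : ℝ)).Finite := Set.finite_range _
  refine hfin.subset ?_
  rintro α ⟨⟨⟨hα0, hα1⟩, φ, hφ, hnot⟩, hlo, -⟩
  by_contra hcon
  apply hnot
  have hpow : 1 ≤ 2 ^ m := Nat.one_le_two_pow
  refine zero_one (D := D) rfl hα0 hα1 ?_ ?_ (by omega) (by omega) (by omega) φ hφ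
  · have hp : 1 ≤ 2 ^ m := Nat.one_le_two_pow
    rw [Nat.cast_sub hp]
    push_cast
    have e : m + 2 - 1 = m + 1 := by omega
    rw [e] at hlo
    have h1 : 1 - α < 1 / (2:ℝ) ^ (m + 1) := by linarith
    rw [lt_div_iff₀ (by positivity), pow_succ] at h1
    linarith
  · intro v e hv he hv0 heq
    apply hcon
    refine ⟨(⟨v, by omega⟩, ⟨e, by omega⟩), ?_⟩
    have he0 : (e : ℝ) ≠ 0 := by
      intro h
      rw [h, mul_zero] at heq
      exact hv0 (by exact_mod_cast heq)
    simp only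
    rw [heq]
    field_simp

end RandomGraphSpectra

namespace RandomGraphSpectra

/-- For every `k > 3`, the set `S_k^1 ∩ (1 - 1/2^{k-1}, 1)` is finite. -/
theorem finite_spectrum_near_one (k : ℕ) (hk : 3 < k) :
    (S1 k ∩ Set.Ioo (1 - 1 / (2 : ℝ) ^ (k - 1)) 1).Finite := by
  exact main_finite k hk

end RandomGraphSpectra
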